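/- arXiv:1305.6582 — 2 statements merged into one kernel-verified Lean document; each statement's English description precedes it below -/
import Mathlib

section
/- Let (k_1, k_1^{-1}, e_1, f_1, k_2, k_2^{-1}, e_2, f_2) be a module-algebra structure of U_q(sl(3)) on the quantum 3-space A_q(3) with k_1(x_1) = x_1, k_1(x_2) = qx_2, k_1(x_3) = q⁻¹x_3, k_2(x_1) = qx_1, k_2(x_2) = q⁻²x_2, k_2(x_3) = q⁻¹x_3. Then there exist b₃, b₀ ∈ ℂ∖{0} such that e_1(x_1) = 0, e_1(x_2) = 0, e_1(x_3) = b₃x_2, e_2(x_1) = 0, e_2(x_2) = b₀·1, e_2(x_3) = 0, f_1(x_1) = 0, f_1(x_2) = b₃⁻¹x_3, f_1(x_3) = 0, f_2(x_1) = b₀⁻¹x_1x_2, f_2(x_2) = −qb₀⁻¹x_2², f_2(x_3) = −qb₀⁻¹x_2x_3. Conversely, each such assignment defines a module-algebra structure of U_q(sl(3)) on A_q(3), and every such structure is isomorphic to the one with b₀ = b₃ = 1. -/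
noncomputable section

open scoped BigOperators

/-- The defining relations of the quantum `n`-space `A_q(n)`:
`x_i x_j = q • (x_j x_i)` for `i > j`. -/
inductive QRel (q : ℂ) (n : ℕ) : FreeAlgebra ℂ (Fin n) → FreeAlgebra ℂ (Fin n) → Prop
  | rel (i j : Fin n) (h : j < i) :
      QRel q n (FreeAlgebra.ι ℂ i * FreeAlgebra.ι ℂ j)
        (q • (FreeAlgebra.ι ℂ j * FreeAlgebra.ι ℂ i))

/-- The quantum `n`-space `A_q(n)`. -/
abbrev QSpace (q : ℂ) (n : ℕ) : Type := RingQuot (QRel q n)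

/-- The generator `x_i` of the quantum `n`-space. -/
def Xg (q : ℂ) (n : ℕ) (i : Fin n) : QSpace q n :=
  RingQuot.mkAlgHom ℂ (QRel q n) (FreeAlgebra.ι ℂ i)

/-- The Cartan matrix of `sl(m+1)`: `a_{ii} = 2`, `a_{ij} = -1` if `|i-j| = 1`,
`a_{ij} = 0` if `|i-j| > 1`. -/
def cartan (m : ℕ) (i j : Fin m) : ℤ :=
  if i = j then 2 else if ((i : ℤ) - (j : ℤ)).natAbs = 1 then -1 else 0

/-- A module-algebra structure of `U_q(sl(m+1))` on a unital `ℂ`-algebra `A`: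
`ℂ`-linear maps `k_i` (unital algebra automorphisms with two-sided inverses `(k i).symm`),
`e_i`, `f_i` for `1 ≤ i ≤ m`, satisfying the twisted Leibniz rules and the defining
operator relations of `U_q(sl(m+1))`. -/
structure UqslMA (q : ℂ) (m : ℕ) (A : Type) [Ring A] [Algebra ℂ A] where
  k : Fin m → (A ≃ₐ[ℂ] A)
  e : Fin m → (A →ₗ[ℂ] A)
  f : Fin m → (A →ₗ[ℂ] A)
  e_mul : ∀ (i : Fin m) (a b : A), e i (a * b) = a * e i b + e i a * k i b
  f_mul : ∀ (i : Fin m) (a b : A), f i (a * b) = (k i).symm a * f i b + f i a * b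
  e_one : ∀ i : Fin m, e i 1 = 0
  f_one : ∀ i : Fin m, f i 1 = 0
  k_comm : ∀ (i j : Fin m) (a : A), k i (k j a) = k j (k i a)
  ke : ∀ (i j : Fin m) (a : A), k i (e j ((k i).symm a)) = q ^ cartan m i j • e j a
  kf : ∀ (i j : Fin m) (a : A), k i (f j ((k i).symm a)) = q ^ (-cartan m i j) • f j a
  ef : ∀ (i j : Fin m) (a : A),
      e i (f j a) - f j (e i a) =
        if i = j then (q - q⁻¹)⁻¹ • (k i a - (k i).symm a) else 0
  ee_comm : ∀ i j : Fin m, cartan m i j = 0 → ∀ a : A, e i (e j a) = e j (e i a)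
  ff_comm : ∀ i j : Fin m, cartan m i j = 0 → ∀ a : A, f i (f j a) = f j (f i a)
  serre_e : ∀ i j : Fin m, cartan m i j = -1 → ∀ a : A,
      e i (e i (e j a)) - (q + q⁻¹) • e i (e j (e i a)) + e j (e i (e i a)) = 0
  serre_f : ∀ i j : Fin m, cartan m i j = -1 → ∀ a : A,
      f i (f i (f j a)) - (q + q⁻¹) • f i (f j (f i a)) + f j (f i (f i a)) = 0

/-- Isomorphism of module-algebra structures: an algebra automorphism `ψ` of `A` with
`ψ ∘ π₁(h) ∘ ψ⁻¹ = π₂(h)` for every generator `h ∈ {k_i^{±1}, e_i, f_i}`. -/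
def UqslMA.Iso {q : ℂ} {m : ℕ} {A : Type} [Ring A] [Algebra ℂ A]
    (π₁ π₂ : UqslMA q m A) : Prop :=
  ∃ ψ : A ≃ₐ[ℂ] A,
    (∀ (i : Fin m) (a : A), ψ (π₁.k i (ψ.symm a)) = π₂.k i a) ∧
    (∀ (i : Fin m) (a : A), ψ ((π₁.k i).symm (ψ.symm a)) = (π₂.k i).symm a) ∧
    (∀ (i : Fin m) (a : A), ψ (π₁.e i (ψ.symm a)) = π₂.e i a) ∧
    (∀ (i : Fin m) (a : A), ψ (π₁.f i (ψ.symm a)) = π₂.f i a)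

/-- The generator `x_1` of the quantum 3-space. -/
def Z1 (q : ℂ) : QSpace q 3 := Xg q 3 0
/-- The generator `x_2` of the quantum 3-space. -/
def Z2 (q : ℂ) : QSpace q 3 := Xg q 3 1
/-- The generator `x_3` of the quantum 3-space. -/
def Z3 (q : ℂ) : QSpace q 3 := Xg q 3 2

/-- The `k`-action of case `(A5)|(B6)`. -/
def KCond16 (q : ℂ) (π : UqslMA q 2 (QSpace q 3)) : Prop :=
  π.k 0 (Z1 q) = Z1 q ∧ π.k 0 (Z2 q) = q • Z2 q ∧ π.k 0 (Z3 q) = q⁻¹ • Z3 q ∧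
  π.k 1 (Z1 q) = q • Z1 q ∧ π.k 1 (Z2 q) = (q ^ (-2 : ℤ)) • Z2 q ∧
  π.k 1 (Z3 q) = q⁻¹ • Z3 q

/-- The `e`/`f`-action of case `(A5)|(B6)` with parameters `b₃`, `b₀`. -/
def EFDesc16 (q : ℂ) (π : UqslMA q 2 (QSpace q 3)) (b₃ b₀ : ℂ) : Prop :=
  π.e 0 (Z1 q) = 0 ∧ π.e 0 (Z2 q) = 0 ∧ π.e 0 (Z3 q) = b₃ • Z2 q ∧
  π.e 1 (Z1 q) = 0 ∧ π.e 1 (Z2 q) = b₀ • 1 ∧ π.e 1 (Z3 q) = 0 ∧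
  π.f 0 (Z1 q) = 0 ∧ π.f 0 (Z2 q) = b₃⁻¹ • Z3 q ∧ π.f 0 (Z3 q) = 0 ∧
  π.f 1 (Z1 q) = b₀⁻¹ • (Z1 q * Z2 q) ∧
  π.f 1 (Z2 q) = (-q * b₀⁻¹) • (Z2 q ^ 2) ∧
  π.f 1 (Z3 q) = (-q * b₀⁻¹) • (Z2 q * Z3 q)


namespace QSpace

variable {q : ℂ} {n : ℕ}

theorem Xg_mul_Xg {i j : Fin n} (h : j < i) : Xg q n i * Xg q n j = q • (Xg q n j * Xg q n i) := by
  have := RingQuot.mkAlgHom_rel ℂ (QRel.rel (q := q) i j h)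
  rwa [map_mul, map_smul, map_mul] at this

theorem induction {P : QSpace q n → Prop} (one : P 1) (gen : ∀ i, P (Xg q n i))
    (smul : ∀ (c : ℂ) a, P a → P (c • a)) (add : ∀ a b, P a → P b → P (a + b))
    (mul : ∀ a b, P a → P b → P (a * b)) (a : QSpace q n) : P a := by
  obtain ⟨b, rfl⟩ := RingQuot.mkAlgHom_surjective ℂ (QRel q n) a
  induction b using FreeAlgebra.induction with
  | grade0 r =>
    rw [Algebra.algebraMap_eq_smul_one, map_smul, map_one]
    exact smul _ _ one
  | grade1 i => exact gen i
  | mul a b ha hb => rw [map_mul]; exact mul _ _ ha hb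
  | add a b ha hb => rw [map_add]; exact add _ _ ha hb

/-- The algebra homomorphism out of the quantum space determined by images of the generators. -/
def lift {B : Type*} [Ring B] [Algebra ℂ B] (u : Fin n → B)
    (h : ∀ i j, j < i → u i * u j = q • (u j * u i)) : QSpace q n →ₐ[ℂ] B :=
  RingQuot.liftAlgHom ℂ ⟨FreeAlgebra.lift ℂ u, by
    rintro _ _ ⟨i, j, hij⟩
    simpa using h i j hij⟩

@[simp]
theorem lift_Xg {B : Type*} [Ring B] [Algebra ℂ B] (u : Fin n → B)
    (h : ∀ i j, j < i → u i * u j = q • (u j * u i)) (i : Fin n) : lift u h (Xg q n i) = u i := by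
  rw [lift, Xg, RingQuot.liftAlgHom_mkAlgHom_apply, FreeAlgebra.lift_ι_apply]

theorem algHom_eq {B : Type*} [Ring B] [Algebra ℂ B] {φ ψ : QSpace q n →ₐ[ℂ] B}
    (h : ∀ i, φ (Xg q n i) = ψ (Xg q n i)) (a : QSpace q n) : φ a = ψ a := by
  induction a using QSpace.induction with
  | one => simp
  | gen i => exact h i
  | smul c a ha => simp [ha]
  | add a b ha hb => simp [ha, hb]
  | mul a b ha hb => simp [ha, hb]

theorem algEquiv_symm_Xg {k : QSpace q n ≃ₐ[ℂ] QSpace q n} {i : Fin n} {c : ℂ} (hc : c ≠ 0)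
    (h : k (Xg q n i) = c • Xg q n i) : k.symm (Xg q n i) = c⁻¹ • Xg q n i := by
  rw [AlgEquiv.symm_apply_eq, map_smul, h, smul_smul, inv_mul_cancel₀ hc, one_smul]

/-- The endomorphism rescaling the generators. -/
def diagHom (c : Fin n → ℂ) : QSpace q n →ₐ[ℂ] QSpace q n :=
  lift (fun i => c i • Xg q n i) fun i j h => by
    rw [smul_mul_smul_comm, smul_mul_smul_comm, Xg_mul_Xg h, smul_comm q, mul_comm (c i)]

/-- The automorphism rescaling the generators by nonzero scalars. -/
def diag (c : Fin n → ℂ) (hc : ∀ i, c i ≠ 0) : QSpace q n ≃ₐ[ℂ] QSpace q n :=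
  AlgEquiv.ofAlgHom (diagHom c) (diagHom fun i => (c i)⁻¹)
    (AlgHom.ext <| algHom_eq (by simp [diagHom, smul_smul, hc]))
    (AlgHom.ext <| algHom_eq (by simp [diagHom, smul_smul, hc]))

theorem diag_Xg (c : Fin n → ℂ) (hc : ∀ i, c i ≠ 0) (i : Fin n) :
    diag (q := q) c hc (Xg q n i) = c i • Xg q n i :=
  lift_Xg _ _ i

/-- A `(g, h)`-twisted derivation may be prescribed on the generators, subject to
compatibility with the defining relations. -/
theorem exists_twistedDerivation (g h : QSpace q n →ₐ[ℂ] QSpace q n) (u : Fin n → QSpace q n)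
    (hu : ∀ i j, j < i → g (Xg q n i) * u j + u i * h (Xg q n j) =
      q • (g (Xg q n j) * u i + u j * h (Xg q n i))) :
    ∃ D : QSpace q n →ₗ[ℂ] QSpace q n,
      (∀ a b, D (a * b) = g a * D b + D a * h b) ∧ ∀ i, D (Xg q n i) = u i := by
  let Φ : QSpace q n →ₐ[ℂ] Matrix (Fin 2) (Fin 2) (QSpace q n) :=
    lift (fun i => !![g (Xg q n i), u i; 0, h (Xg q n i)]) fun i j hij => by
      have h₁ := congrArg g (Xg_mul_Xg (q := q) hij)
      have h₂ := congrArg h (Xg_mul_Xg (q := q) hij)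
      simp only [map_mul, map_smul] at h₁ h₂
      simp [Matrix.smul_of, h₁, h₂, hu i j hij]
  have key : ∀ a, Φ a 0 0 = g a ∧ Φ a 1 0 = 0 ∧ Φ a 1 1 = h a := by
    intro a
    induction a using QSpace.induction with
    | one => simp
    | gen i => simp [Φ]
    | smul c a ha => simp [ha]
    | add a b ha hb => simp [ha, hb]
    | mul a b ha hb => simp [ha, hb, Matrix.mul_apply, Fin.sum_univ_two]
  refine ⟨⟨⟨fun a => Φ a 0 1, by simp⟩, by simp⟩, fun a b => ?_, fun i => by simp [Φ]⟩
  simp [Matrix.mul_apply, Fin.sum_univ_two, key]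

/-- Additive twisted derivations that agree on the generators are equal. -/
theorem twistedDerivation_eq {B : Type*} [Ring B] [Algebra ℂ B] {g h : QSpace q n → B}
    {D D' : QSpace q n →ₗ[ℂ] B}
    (hD : ∀ a b, D (a * b) = g a * D b + D a * h b)
    (hD' : ∀ a b, D' (a * b) = g a * D' b + D' a * h b)
    (h1 : D 1 = D' 1) (hX : ∀ i, D (Xg q n i) = D' (Xg q n i)) (a : QSpace q n) : D a = D' a := by
  induction a using QSpace.induction with
  | one => exact h1
  | gen i => exact hX i
  | smul c a ha => simp [ha]
  | add a b ha hb => simp [ha, hb]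
  | mul a b ha hb => rw [hD, hD', ha, hb]

end QSpace

/-! ### The regular representation on functions on the exponent lattice -/

/-- The exponent of `q` arising when the ordered monomials with exponents `m` and `n`
are multiplied. -/
def twist (m n : ℤ × ℤ × ℤ) : ℤ := (m.2.1 + m.2.2) * n.1 + m.2.2 * n.2.1

theorem twist_add_left (m n p : ℤ × ℤ × ℤ) : twist (m + n) p = twist m p + twist n p := by
  simp only [twist, Prod.fst_add, Prod.snd_add]; ring

theorem twist_add_right (m n p : ℤ × ℤ × ℤ) : twist p (m + n) = twist p m + twist p n := by
  simp only [twist, Prod.fst_add, Prod.snd_add]; ring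

/-- The left multiplication by the Laurent monomial with exponent `n`. -/
def qShift (q : ℂ) (n : ℤ × ℤ × ℤ) : Module.End ℂ (ℤ × ℤ × ℤ → ℂ) where
  toFun φ m := q ^ twist n (m - n) * φ (m - n)
  map_add' φ ψ := by ext m; simp [mul_add]
  map_smul' c φ := by ext m; simp [mul_left_comm]

theorem qShift_apply (q : ℂ) (n m : ℤ × ℤ × ℤ) (φ : ℤ × ℤ × ℤ → ℂ) :
    qShift q n φ m = q ^ twist n (m - n) * φ (m - n) := rfl

theorem qShift_zero (q : ℂ) : qShift q 0 = 1 := by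
  ext φ m
  simp [qShift_apply, twist]

theorem qShift_single (q : ℂ) (n : ℤ × ℤ × ℤ) : qShift q n (Pi.single 0 1) = Pi.single n 1 := by
  ext m
  rw [qShift_apply]
  by_cases h : m = n
  · subst h; simp [twist]
  · simp [h, sub_eq_zero]

section

variable {q : ℂ} (hq : q ≠ 0)
include hq

theorem qShift_mul (m n : ℤ × ℤ × ℤ) :
    qShift q m * qShift q n = q ^ twist m n • qShift q (m + n) := by
  ext φ p
  have h : twist m (p - m) = twist m n + twist m (p - (m + n)) := by
    rw [← twist_add_right]; congr 1; abel
  simp only [Module.End.mul_apply, LinearMap.smul_apply, Pi.smul_apply, qShift_apply, smul_eq_mul,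
    h, twist_add_left, zpow_add₀ hq, sub_sub]
  ring

theorem qShift_comm (m n : ℤ × ℤ × ℤ) :
    qShift q m * qShift q n = q ^ (twist m n - twist n m) • (qShift q n * qShift q m) := by
  rw [qShift_mul hq, qShift_mul hq, smul_smul, ← zpow_add₀ hq, add_comm n m]
  congr 2; ring

theorem qShift_mul_ne (m n : ℤ × ℤ × ℤ) :
    qShift q (m + n) = q ^ (-twist m n) • (qShift q m * qShift q n) := by
  rw [qShift_mul hq, smul_smul, ← zpow_add₀ hq, neg_add_cancel, zpow_zero, one_smul]

theorem exists_qShift_pow (m : ℤ × ℤ × ℤ) (d : ℕ) :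
    ∃ c : ℂ, c ≠ 0 ∧ qShift q m ^ d = c • qShift q (d • m) := by
  induction d with
  | zero => exact ⟨1, one_ne_zero, by simp [qShift_zero]⟩
  | succ d ih =>
    obtain ⟨c, hc, h⟩ := ih
    refine ⟨c * q ^ twist (d • m) m, mul_ne_zero hc (zpow_ne_zero _ hq), ?_⟩
    rw [pow_succ, h, smul_mul_assoc, qShift_mul hq, smul_smul, succ_nsmul]

theorem qShift_isUnit (m : ℤ × ℤ × ℤ) : IsUnit (qShift q m) := by
  have h (n : ℤ × ℤ × ℤ) : qShift q n * (q ^ (-twist n (-n)) • qShift q (-n)) = 1 := by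
    rw [mul_smul_comm, ← qShift_mul_ne hq, add_neg_cancel, qShift_zero]
  refine ⟨⟨_, _, h m, ?_⟩, rfl⟩
  have h' := h (-m)
  rw [neg_neg, mul_smul_comm] at h'
  rw [smul_mul_assoc, ← h']
  congr 2
  simp [twist]
  ring

end

/-- The exponents of the generators. -/
def genExp : Fin 3 → ℤ × ℤ × ℤ := ![(1, 0, 0), (0, 1, 0), (0, 0, 1)]

/-- The regular representation of the quantum 3-space. -/
def regRep {q : ℂ} (hq : q ≠ 0) : QSpace q 3 →ₐ[ℂ] Module.End ℂ (ℤ × ℤ × ℤ → ℂ) :=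
  QSpace.lift (fun i => qShift q (genExp i)) fun i j h => by
    rw [qShift_comm hq]
    fin_cases i <;> fin_cases j <;> simp_all [genExp, twist]

theorem regRep_Xg {q : ℂ} (hq : q ≠ 0) (i : Fin 3) :
    regRep hq (Xg q 3 i) = qShift q (genExp i) := QSpace.lift_Xg _ _ i

/-- The ordered monomials. -/
def qMono (q : ℂ) (m : ℕ × ℕ × ℕ) : QSpace q 3 :=
  Xg q 3 0 ^ m.1 * Xg q 3 1 ^ m.2.1 * Xg q 3 2 ^ m.2.2

/-- The exponent of an ordered monomial in the lattice. -/
def latExp (m : ℕ × ℕ × ℕ) : ℤ × ℤ × ℤ := (m.1, m.2.1, m.2.2)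

theorem latExp_injective : Function.Injective latExp := by
  rintro ⟨a, b, c⟩ ⟨a', b', c'⟩ h
  simpa [latExp] using h

theorem regRep_qMono {q : ℂ} (hq : q ≠ 0) (m : ℕ × ℕ × ℕ) :
    regRep hq (qMono q m) = qShift q (latExp m) := by
  have key (i : Fin 3) (d : ℕ) : qShift q (genExp i) ^ d = qShift q (d • genExp i) := by
    induction d with
    | zero => simp [qShift_zero]
    | succ d ih =>
      rw [pow_succ, ih, qShift_mul hq, succ_nsmul]
      fin_cases i <;> simp [genExp, twist]
  simp only [qMono, map_mul, map_pow, regRep_Xg, key, qShift_mul hq, smul_mul_assoc, smul_smul]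
  simp [genExp, twist, latExp]

theorem mul_pow_of_qcomm {B : Type*} [Ring B] [Algebra ℂ B] {q : ℂ} {x y : B}
    (h : y * x = q • (x * y)) (d : ℕ) : y * x ^ d = q ^ d • (x ^ d * y) := by
  induction d with
  | zero => simp
  | succ d ih => rw [pow_succ, ← mul_assoc, ih, smul_mul_assoc, mul_assoc, h, mul_smul_comm,
      smul_smul, pow_succ, mul_assoc]

theorem span_qMono (q : ℂ) : Submodule.span ℂ (Set.range (qMono q)) = ⊤ := by
  rw [eq_top_iff]
  have gen (i : Fin 3) (m : ℕ × ℕ × ℕ) :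
      Xg q 3 i * qMono q m ∈ Submodule.span ℂ (Set.range (qMono q)) := by
    obtain ⟨a, b, c⟩ := m
    have h10 := mul_pow_of_qcomm (QSpace.Xg_mul_Xg (q := q) (show (0 : Fin 3) < 1 by decide)) a
    have h20 := mul_pow_of_qcomm (QSpace.Xg_mul_Xg (q := q) (show (0 : Fin 3) < 2 by decide)) a
    have h21 := mul_pow_of_qcomm (QSpace.Xg_mul_Xg (q := q) (show (1 : Fin 3) < 2 by decide)) b
    have mem (m : ℕ × ℕ × ℕ) (r : ℂ) :
        r • qMono q m ∈ Submodule.span ℂ (Set.range (qMono q)) :=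
      Submodule.smul_mem _ _ (Submodule.subset_span ⟨m, rfl⟩)
    fin_cases i
    · convert mem (a + 1, b, c) 1 using 1
      simp [qMono, pow_succ', mul_assoc]
    · convert mem (a, b + 1, c) (q ^ a) using 1
      simp only [qMono, Fin.mk_one]
      rw [← mul_assoc, ← mul_assoc, h10]
      simp [pow_succ', mul_assoc]
    · convert mem (a, b, c + 1) (q ^ a * q ^ b) using 1
      simp only [qMono, Fin.reduceFinMk]
      rw [← mul_assoc, ← mul_assoc, h20, smul_mul_assoc, mul_assoc (Xg q 3 0 ^ a), h21]
      simp [pow_succ', mul_assoc, smul_smul]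
  have step (a s : QSpace q 3) : s ∈ Submodule.span ℂ (Set.range (qMono q)) →
      a * s ∈ Submodule.span ℂ (Set.range (qMono q)) := by
    induction a using QSpace.induction generalizing s with
    | one => simp
    | gen i =>
      intro hs
      induction hs using Submodule.span_induction with
      | mem x hx => obtain ⟨m, rfl⟩ := hx; exact gen i m
      | zero => simp
      | add x y _ _ hx hy => rw [mul_add]; exact add_mem hx hy
      | smul r x _ hx => rw [mul_smul_comm]; exact Submodule.smul_mem _ _ hx
    | smul c a ha => intro hs; rw [smul_mul_assoc]; exact Submodule.smul_mem _ _ (ha s hs)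
    | add a b ha hb => intro hs; rw [add_mul]; exact add_mem (ha s hs) (hb s hs)
    | mul a b ha hb => intro hs; rw [mul_assoc]; exact ha _ (hb s hs)
  intro a _
  simpa using step a 1 (Submodule.subset_span ⟨0, by simp [qMono]⟩)

theorem exists_finsupp_qMono {q : ℂ} (a : QSpace q 3) :
    ∃ c : (ℕ × ℕ × ℕ) →₀ ℂ, (c.sum fun m r => r • qMono q m) = a :=
  Finsupp.mem_span_range_iff_exists_finsupp.1 (span_qMono q ▸ Submodule.mem_top)

theorem regRep_sum_single {q : ℂ} (hq : q ≠ 0) (c : (ℕ × ℕ × ℕ) →₀ ℂ) (m : ℕ × ℕ × ℕ) :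
    regRep hq (c.sum fun m r => r • qMono q m) (Pi.single 0 1) (latExp m) = c m := by
  classical
  simp only [Finsupp.sum, map_sum, map_smul, regRep_qMono, LinearMap.sum_apply,
    LinearMap.smul_apply, qShift_single, Finset.sum_apply, Pi.smul_apply, smul_eq_mul]
  rw [Finset.sum_eq_single m]
  · simp
  · intro n _ hn
    rw [Pi.single_eq_of_ne (fun h => hn (latExp_injective h.symm)), mul_zero]
  · intro h; simp [Finsupp.notMem_support_iff.1 h]

theorem qMono_coeff_ext {q : ℂ} (hq : q ≠ 0) {c c' : (ℕ × ℕ × ℕ) →₀ ℂ}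
    (h : (c.sum fun m r => r • qMono q m) = c'.sum fun m r => r • qMono q m) : c = c' := by
  ext m
  rw [← regRep_sum_single hq, h, regRep_sum_single hq]

theorem regRep_injective {q : ℂ} (hq : q ≠ 0) : Function.Injective (regRep hq) := by
  intro a b h
  obtain ⟨c, rfl⟩ := exists_finsupp_qMono a
  obtain ⟨c', rfl⟩ := exists_finsupp_qMono b
  congr 1
  ext m
  rw [← regRep_sum_single hq, h, regRep_sum_single hq]

open Polynomial in
/-- The substitution `X ↦ c X`. -/
def scaleVar (c : ℂ) (P : ℂ[X]) : ℂ[X] := P.comp (C c * X)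

theorem scaleVar_coeff (c : ℂ) (P : Polynomial ℂ) (d : ℕ) :
    (scaleVar c P).coeff d = P.coeff d * c ^ d := Polynomial.comp_C_mul_X_coeff

/-- The exponent of the commutation factor between two Laurent monomials. -/
def comm3 (m n : ℤ × ℤ × ℤ) : ℤ := twist m n - twist n m

/-- The exponent of the monomial of weight zero. -/
def tauExp : ℤ × ℤ × ℤ := (3, 1, 1)

/-- The polynomial `P` evaluated at the monomial of weight zero. -/
def tauEval (q : ℂ) : Polynomial ℂ →ₐ[ℂ] Module.End ℂ (ℤ × ℤ × ℤ → ℂ) :=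
  Polynomial.aeval (qShift q tauExp)

section

variable {q : ℂ} (hq : q ≠ 0)
include hq

theorem qShift_comm3 (m n : ℤ × ℤ × ℤ) :
    qShift q m * qShift q n = q ^ comm3 m n • (qShift q n * qShift q m) := qShift_comm hq m n

theorem tauEval_mul_qShift (P : Polynomial ℂ) (n : ℤ × ℤ × ℤ) :
    tauEval q P * qShift q n = qShift q n * tauEval q (scaleVar (q ^ comm3 tauExp n) P) := by
  induction P using Polynomial.induction_on' with
  | add P Q hP hQ => simp only [scaleVar, Polynomial.add_comp, map_add, add_mul, mul_add] at *
                     rw [hP, hQ]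
  | monomial d r =>
    have h : scaleVar (q ^ comm3 tauExp n) (Polynomial.monomial d r) =
        (q ^ comm3 tauExp n) ^ d • Polynomial.monomial d r := by
      ext e
      rw [scaleVar_coeff, Polynomial.coeff_smul, Polynomial.coeff_monomial, smul_eq_mul]
      split_ifs with h
      · rw [h, mul_comm]
      · simp
    rw [h, map_smul, tauEval, Polynomial.aeval_monomial, ← Algebra.smul_def, smul_mul_assoc,
      smul_comm _ r, mul_smul_comm]
    congr 1
    clear h
    induction d with
    | zero => simp
    | succ d ih =>
      rw [pow_succ, mul_assoc, qShift_comm3 hq tauExp, mul_smul_comm, ← mul_assoc, ih,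
        mul_smul_comm, mul_smul_comm, smul_mul_assoc, smul_smul, mul_assoc, ← pow_succ']

theorem tauEval_injective : Function.Injective (tauEval q) := by
  intro P Q h
  rw [← sub_eq_zero] at h ⊢
  rw [← map_sub] at h
  generalize P - Q = R at h
  ext e
  obtain ⟨c, hc, hce⟩ := exists_qShift_pow hq tauExp e
  have h' := congrFun (LinearMap.congr_fun h (Pi.single 0 1)) (e • tauExp)
  rw [tauEval, Polynomial.aeval_eq_sum_range, LinearMap.sum_apply, Finset.sum_apply,
    Finset.sum_eq_single e] at h'
  · rw [LinearMap.smul_apply, hce, LinearMap.smul_apply, qShift_single] at h'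
    simpa [hc] using h'
  · intro d _ hd
    obtain ⟨c', -, hc'⟩ := exists_qShift_pow hq tauExp d
    rw [LinearMap.smul_apply, hc', LinearMap.smul_apply, qShift_single, Pi.smul_apply,
      Pi.smul_apply, Pi.single_eq_of_ne, smul_zero, smul_zero]
    intro he
    have := congrArg (fun m => m.2.1) he
    simp only [tauExp, Prod.smul_mk, nsmul_eq_mul, mul_one] at this
    exact hd (by exact_mod_cast this.symm)
  · intro he
    rw [Polynomial.coeff_eq_zero_of_natDegree_lt (by simpa using he), zero_smul]; rfl

/-- Commuting `y P(t)` past a generator. -/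
theorem qShift_tauEval_mul_qShift (y n : ℤ × ℤ × ℤ) (P : Polynomial ℂ) :
    qShift q y * tauEval q P * qShift q n =
      qShift q n * (qShift q y * tauEval q (q ^ comm3 y n • scaleVar (q ^ comm3 tauExp n) P)) := by
  rw [mul_assoc, tauEval_mul_qShift hq, ← mul_assoc, qShift_comm3 hq y, smul_mul_assoc, map_smul,
    mul_smul_comm, mul_smul_comm, mul_assoc]

end

theorem exists_coeff_of_cocycle {ι : Type*} [Fintype ι] (U : ι → Polynomial ℂ) (l : ι → ℕ → ℂ)
    (h : ∀ i j d, (U i).coeff d * l j d = (U j).coeff d * l i d) (hl : ∀ d, ∃ j, l j d ≠ 0) :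
    ∃ P : Polynomial ℂ, ∀ i d, (U i).coeff d = l i d * P.coeff d := by
  choose j hj using hl
  refine ⟨∑ d ∈ Finset.range (∑ i, (U i).natDegree + 1),
    Polynomial.monomial d ((U (j d)).coeff d / l (j d) d), fun i d => ?_⟩
  simp only [Polynomial.finsetSum_coeff, Polynomial.coeff_monomial, Finset.sum_ite_eq',
    Finset.mem_range]
  split_ifs with hd
  · rw [mul_div_assoc', eq_div_iff (hj d), h i (j d) d, mul_comm]
  · rw [mul_zero]
    refine Polynomial.coeff_eq_zero_of_natDegree_lt ?_
    have := Finset.single_le_sum (f := fun i => (U i).natDegree) (fun _ _ => Nat.zero_le _)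
      (Finset.mem_univ i)
    omega

/-- A twisted derivation of the quantum 3-space whose values on the generators lie in the
spaces `x_j y ℂ[t]` becomes inner in the ring of operators. -/
theorem exists_inner {q : ℂ} (hq : q ≠ 0) (hq' : ∀ n : ℤ, q ^ n = 1 → n = 0)
    {k : QSpace q 3 →ₐ[ℂ] QSpace q 3} {α : Fin 3 → ℤ}
    (hk : ∀ j, k (Xg q 3 j) = q ^ α j • Xg q 3 j) {E : QSpace q 3 →ₗ[ℂ] QSpace q 3}
    (hE : ∀ a b, E (a * b) = a * E b + E a * k b) {y : ℤ × ℤ × ℤ} {U : Fin 3 → Polynomial ℂ}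
    (hU : ∀ j, regRep hq (E (Xg q 3 j)) = qShift q (genExp j) * (qShift q y * tauEval q (U j)))
    (hne : ∀ d : ℕ, ∃ j, α j + comm3 y (genExp j) + d * comm3 tauExp (genExp j) ≠ 0) :
    ∃ P : Polynomial ℂ,
      (∀ j d, (U j).coeff d =
        (q ^ (α j + comm3 y (genExp j) + d * comm3 tauExp (genExp j)) - 1) * P.coeff d) ∧
      ∀ a, regRep hq (E a) = qShift q y * tauEval q P * regRep hq (k a) -
        regRep hq a * (qShift q y * tauEval q P) := by
  set ℓ : Fin 3 → ℕ → ℤ :=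
    fun j d => α j + comm3 y (genExp j) + d * comm3 tauExp (genExp j) with hℓ
  have hpow (j : Fin 3) (d : ℕ) :
      q ^ ℓ j d = q ^ α j * (q ^ comm3 y (genExp j) * (q ^ comm3 tauExp (genExp j)) ^ d) := by
    rw [hℓ]
    simp only
    rw [zpow_add₀ hq, zpow_add₀ hq, mul_comm (d : ℤ), zpow_mul, zpow_natCast, mul_assoc]
  have hlt (i j : Fin 3) (hij : i < j) (d : ℕ) :
      (U i).coeff d * (q ^ ℓ j d - 1) = (U j).coeff d * (q ^ ℓ i d - 1) := by
    have h := congrArg (fun a => regRep hq (E a)) (QSpace.Xg_mul_Xg (q := q) hij)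
    have hx := congrArg (regRep hq) (QSpace.Xg_mul_Xg (q := q) hij)
    simp only [map_smul, map_mul, hE, map_add, hk, regRep_Xg, hU, mul_smul_comm] at h hx
    rw [mul_assoc (qShift q (genExp j)), mul_assoc (qShift q (genExp i)),
      qShift_tauEval_mul_qShift hq, qShift_tauEval_mul_qShift hq] at h
    have h1 : qShift q (genExp j) * qShift q (genExp i) * (qShift q y * tauEval q
        (U i + q ^ α i • q ^ comm3 y (genExp i) •
          scaleVar (q ^ comm3 tauExp (genExp i)) (U j))) =
        qShift q (genExp j) * qShift q (genExp i) * (qShift q y * tauEval q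
        (U j + q ^ α j • q ^ comm3 y (genExp j) •
          scaleVar (q ^ comm3 tauExp (genExp j)) (U i))) := by
      conv_rhs => rw [hx]
      simp only [map_add, map_smul, mul_add, mul_smul_comm, smul_mul_assoc, mul_assoc,
        smul_add] at h ⊢
      rw [h, smul_comm q (q ^ α j), smul_comm q (q ^ comm3 y (genExp j))]
    have h2 := tauEval_injective hq ((qShift_isUnit hq y).mul_left_cancel
      (((qShift_isUnit hq (genExp j)).mul (qShift_isUnit hq (genExp i))).mul_left_cancel h1))
    have h3 := congrArg (fun P => Polynomial.coeff P d) h2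
    simp only [Polynomial.coeff_add, Polynomial.coeff_smul, scaleVar_coeff, smul_eq_mul] at h3
    rw [hpow, hpow]
    linear_combination -h3
  obtain ⟨P, hP⟩ := exists_coeff_of_cocycle U (fun j d => q ^ ℓ j d - 1)
    (fun i j d => by
      rcases lt_trichotomy i j with h | rfl | h
      · exact hlt i j h d
      · rfl
      · exact (hlt j i h d).symm)
    (fun d => by
      obtain ⟨j, hj⟩ := hne d
      exact ⟨j, fun h => hj (hq' _ (sub_eq_zero.1 h))⟩)
  refine ⟨P, hP, ?_⟩
  let D : QSpace q 3 →ₗ[ℂ] Module.End ℂ (ℤ × ℤ × ℤ → ℂ) :=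
    (LinearMap.mulLeft ℂ (qShift q y * tauEval q P)).comp ((regRep hq).comp k).toLinearMap -
      (LinearMap.mulRight ℂ (qShift q y * tauEval q P)).comp (regRep hq).toLinearMap
  have hD (a : QSpace q 3) : D a = qShift q y * tauEval q P * regRep hq (k a) -
        regRep hq a * (qShift q y * tauEval q P) := rfl
  intro a
  rw [← hD]
  refine QSpace.twistedDerivation_eq (g := regRep hq) (h := fun a => regRep hq (k a))
    (D := (regRep hq).toLinearMap.comp E) (D' := D) ?_ ?_ ?_ ?_ a
  · intro a b; simp [hE]
  · intro a b
    simp only [hD, map_mul, mul_sub, sub_mul, mul_assoc]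
    abel
  · have : E 1 = 0 := by simpa using hE 1 1
    simp [hD, this]
  · intro j
    rw [hD, LinearMap.comp_apply, AlgHom.toLinearMap_apply, hU, hk, map_smul, regRep_Xg,
      mul_smul_comm, qShift_tauEval_mul_qShift hq, ← mul_smul_comm, ← mul_sub, ← mul_smul_comm,
      ← mul_sub, ← map_smul, ← map_sub]
    congr 3
    ext d
    rw [hP]
    simp only [Polynomial.coeff_sub, Polynomial.coeff_smul, scaleVar_coeff, smul_eq_mul]
    rw [hpow]
    ring

theorem sub_inv_ne_zero {q : ℂ} (hq : q ≠ 0) (hq' : ∀ n : ℤ, q ^ n = 1 → n = 0) :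
    q - q⁻¹ ≠ 0 := by
  intro h
  have : q ^ (2 : ℤ) = 1 := by
    rw [sub_eq_zero] at h
    rw [zpow_two]
    nth_rw 1 [h]
    exact inv_mul_cancel₀ hq
  simpa using hq' 2 this

/-- The weights of the Laurent monomials for the two Cartan generators. -/
def lwt (l : Fin 2) (m : ℤ × ℤ × ℤ) : ℤ := ![m.2.1 - m.2.2, m.1 - 2 * m.2.1 - m.2.2] l

theorem lwt_add (l : Fin 2) (m n : ℤ × ℤ × ℤ) : lwt l (m + n) = lwt l m + lwt l n := by
  fin_cases l <;> simp [lwt] <;> ring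

/-- The weights of the raising operators. -/
def rootExp : Fin 2 → ℤ × ℤ × ℤ := ![(0, 1, -1), (0, -1, 0)]

theorem lwt_rootExp (l i : Fin 2) : lwt l (rootExp i) = cartan 2 l i := by
  fin_cases l <;> fin_cases i <;> simp [lwt, rootExp, cartan]

section

variable {q : ℂ} (hq : q ≠ 0) (hq' : ∀ n : ℤ, q ^ n = 1 → n = 0)
include hq

theorem map_qMono {k : QSpace q 3 ≃ₐ[ℂ] QSpace q 3} {l : Fin 2}
    (hk : ∀ j, k (Xg q 3 j) = q ^ lwt l (genExp j) • Xg q 3 j) (m : ℕ × ℕ × ℕ) :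
    k (qMono q m) = q ^ lwt l (latExp m) • qMono q m := by
  simp only [qMono, map_mul, map_pow, hk, smul_pow, smul_mul_smul_comm]
  rw [← zpow_natCast, ← zpow_natCast, ← zpow_natCast, ← zpow_mul, ← zpow_mul, ← zpow_mul,
    ← zpow_add₀ hq, ← zpow_add₀ hq]
  congr 2
  fin_cases l <;> simp [lwt, latExp, genExp] <;> ring

include hq'

/-- Weight vectors are monomials times polynomials in the monomial of weight zero. -/
theorem exists_poly_of_weight {k : Fin 2 → (QSpace q 3 ≃ₐ[ℂ] QSpace q 3)}
    (hk : ∀ l j, k l (Xg q 3 j) = q ^ lwt l (genExp j) • Xg q 3 j) {u : QSpace q 3}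
    {m₀ : ℤ × ℤ × ℤ} (hm₀ : m₀.1 < 3) (hu : ∀ l, k l u = q ^ lwt l m₀ • u) :
    ∃ U, regRep hq u = qShift q m₀ * tauEval q U := by
  obtain ⟨c, rfl⟩ := exists_finsupp_qMono u
  have hc (m : ℕ × ℕ × ℕ) (hm : m ∈ c.support) (l : Fin 2) : lwt l (latExp m) = lwt l m₀ := by
    have h := hu l
    have h1 : k l (c.sum fun m r => r • qMono q m) =
        (Finsupp.onFinset c.support (fun m => q ^ lwt l (latExp m) * c m) (fun m hm =>
          Finsupp.mem_support_iff.2 (right_ne_zero_of_mul hm))).sum fun m r => r • qMono q m := by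
      rw [Finsupp.onFinset_sum _ (fun m => zero_smul ℂ (qMono q m)), Finsupp.sum, map_sum]
      refine Finset.sum_congr rfl fun m _ => ?_
      rw [map_smul, map_qMono hq (hk l), smul_smul, mul_comm]
    have h2 : (q ^ lwt l m₀ • c.sum fun m r => r • qMono q m) =
        (q ^ lwt l m₀ • c).sum fun m r => r • qMono q m := by
      rw [Finsupp.sum_smul_index (fun m => zero_smul ℂ (qMono q m)), Finsupp.smul_sum]
      simp only [smul_smul]
    rw [h1, h2] at h
    have h3 := DFunLike.congr_fun (qMono_coeff_ext hq h) m
    rw [Finsupp.onFinset_apply, Finsupp.smul_apply, smul_eq_mul] at h3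
    have h4 := mul_right_cancel₀ (Finsupp.mem_support_iff.1 hm) h3
    have h5 := hq' (lwt l (latExp m) - lwt l m₀)
      (by rw [zpow_sub₀ hq, h4, div_self (zpow_ne_zero _ hq)])
    omega
  suffices h : regRep hq (c.sum fun m r => r • qMono q m) ∈
      LinearMap.range ((LinearMap.mulLeft ℂ (qShift q m₀)).comp (tauEval q).toLinearMap) by
    obtain ⟨U, hU⟩ := h
    exact ⟨U, hU.symm⟩
  rw [Finsupp.sum, map_sum]
  refine Submodule.sum_mem _ fun m hm => ?_
  rw [map_smul]
  refine Submodule.smul_mem _ _ ?_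
  obtain ⟨a, b, c'⟩ := m
  obtain ⟨a₀, b₀, c₀⟩ := m₀
  have h0 := hc _ hm 0
  have h1 := hc _ hm 1
  simp only [lwt, latExp, Matrix.cons_val_zero, Matrix.cons_val_one] at h0 h1 hm₀
  obtain ⟨d, hd⟩ : ∃ d : ℕ, (b : ℤ) = b₀ + d := ⟨(b - b₀).toNat, by omega⟩
  have hm' : latExp (a, b, c') = (a₀, b₀, c₀) + d • tauExp := by
    simp only [latExp, tauExp, Prod.smul_mk, nsmul_eq_mul, Prod.mk_add_mk, Prod.mk.injEq]
    omega
  obtain ⟨s, hs, hsd⟩ := exists_qShift_pow hq tauExp d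
  have : qShift q (d • tauExp) = s⁻¹ • qShift q tauExp ^ d := by
    rw [hsd, smul_smul, inv_mul_cancel₀ hs, one_smul]
  rw [regRep_qMono, hm', qShift_mul_ne hq, this, mul_smul_comm]
  refine Submodule.smul_mem _ _ (Submodule.smul_mem _ _ ⟨Polynomial.X ^ d, ?_⟩)
  simp [tauEval]

end

theorem exists_inner_of_weight {q : ℂ} (hq : q ≠ 0) (hq' : ∀ n : ℤ, q ^ n = 1 → n = 0)
    {k : Fin 2 → (QSpace q 3 ≃ₐ[ℂ] QSpace q 3)}
    (hk : ∀ l j, k l (Xg q 3 j) = q ^ lwt l (genExp j) • Xg q 3 j) {i : Fin 2}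
    {E : QSpace q 3 →ₗ[ℂ] QSpace q 3} (hE : ∀ a b, E (a * b) = a * E b + E a * k i b)
    {y : ℤ × ℤ × ℤ} (hy : y.1 ≤ 1)
    (hw : ∀ l j, k l (E (Xg q 3 j)) = q ^ lwt l (genExp j + y) • E (Xg q 3 j))
    (hne : ∀ d : ℕ, ∃ j,
      lwt i (genExp j) + comm3 y (genExp j) + d * comm3 tauExp (genExp j) ≠ 0) :
    ∃ P : Polynomial ℂ, ∀ a, regRep hq (E a) = qShift q y * tauEval q P * regRep hq (k i a) -
      regRep hq a * (qShift q y * tauEval q P) := by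
  have h (j : Fin 3) : ∃ U, regRep hq (E (Xg q 3 j)) =
      qShift q (genExp j) * (qShift q y * tauEval q U) := by
    obtain ⟨U, hU⟩ := exists_poly_of_weight hq hq' hk (m₀ := genExp j + y)
      (by fin_cases j <;> simp [genExp] <;> omega) (fun l => hw l j)
    refine ⟨q ^ (-twist (genExp j) y) • U, ?_⟩
    rw [hU, qShift_mul_ne hq, map_smul, mul_smul_comm, mul_smul_comm, smul_mul_assoc, mul_assoc]
  choose U hU using h
  obtain ⟨P, -, hP⟩ := exists_inner (k := (k i : QSpace q 3 →ₐ[ℂ] QSpace q 3)) hq hq' (hk i) hE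
    hU hne
  exact ⟨P, hP⟩

open Polynomial in
theorem natDegree_scaleVar {c : ℂ} (hc : c ≠ 0) (P : ℂ[X]) :
    (scaleVar c P).natDegree = P.natDegree := by
  rw [scaleVar, natDegree_comp, natDegree_C_mul_X _ hc, mul_one]

/-- The commutator relation forces both inner twisted derivations to be of lowest degree. -/
theorem eq_C_of_commutator {q : ℂ} (hq : q ≠ 0) (hq' : ∀ n : ℤ, q ^ n = 1 → n = 0)
    {k : QSpace q 3 ≃ₐ[ℂ] QSpace q 3} {α : Fin 3 → ℤ}
    (hk : ∀ j, k (Xg q 3 j) = q ^ α j • Xg q 3 j) {e f : QSpace q 3 →ₗ[ℂ] QSpace q 3}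
    {y : ℤ × ℤ × ℤ} (hy : comm3 tauExp y = 2) (hy' : comm3 tauExp (-y) = -2)
    (hα : ∃ j, α j ≠ 0)
    (hne : ∀ d : ℕ, 0 < d → ∃ j, 2 * α j + d * comm3 tauExp (genExp j) ≠ 0)
    {P Q : Polynomial ℂ}
    (he : ∀ a, regRep hq (e a) = qShift q y * tauEval q P * regRep hq (k a) -
      regRep hq a * (qShift q y * tauEval q P))
    (hf : ∀ a, regRep hq (k (f a)) = qShift q (-y) * tauEval q Q * regRep hq (k a) -
      regRep hq a * (qShift q (-y) * tauEval q Q))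
    (hke : ∀ a, k (e (k.symm a)) = q ^ (2 : ℤ) • e a)
    (hkf : ∀ a, k (f (k.symm a)) = q ^ (-2 : ℤ) • f a)
    (hef : ∀ a, e (f a) - f (e a) = (q - q⁻¹)⁻¹ • (k a - k.symm a)) :
    ∃ p r, P = Polynomial.C p ∧ Q = Polynomial.C r := by
  have hq2 : q ^ (2 : ℤ) ≠ 0 := zpow_ne_zero _ hq
  have hq2' : q ^ (2 : ℤ) * q ^ (-2 : ℤ) = 1 := by rw [← zpow_add₀ hq]; simp
  have hqq := sub_inv_ne_zero hq hq'
  set w := qShift q y * tauEval q P with hw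
  set v := qShift q (-y) * tauEval q Q with hv
  set ρ := regRep hq with hρ
  have hf' (a : QSpace q 3) : ρ (f a) = q ^ (2 : ℤ) • (v * ρ a - ρ (k.symm a) * v) := by
    have := hf (k.symm a)
    rw [hkf, map_smul, k.apply_symm_apply] at this
    rw [← this, smul_smul, hq2', one_smul]
  have hkf' (a : QSpace q 3) : k (f a) = q ^ (-2 : ℤ) • f (k a) := by
    rw [← hkf, k.symm_apply_apply]
  have hke' (a : QSpace q 3) : k.symm (e a) = q ^ (-2 : ℤ) • e (k.symm a) := by
    rw [AlgEquiv.symm_apply_eq, map_smul, hke, smul_smul, mul_comm, hq2', one_smul]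
  set z := w * v - q ^ (2 : ℤ) • (v * w) with hz
  have hzρ (a : QSpace q 3) :
      z * ρ (k a) - ρ (k.symm a) * z = (q - q⁻¹)⁻¹ • (ρ (k a) - ρ (k.symm a)) := by
    have h := congrArg ρ (hef a)
    rw [map_sub, he (f a), hkf', hf' (e a), hke', map_smul, map_smul, hf', hf', he, he,
      map_smul, map_sub, k.symm_apply_apply, k.apply_symm_apply] at h
    rw [← h, hz]
    simp only [mul_sub, sub_mul, smul_sub, mul_smul_comm, smul_mul_assoc, smul_smul, hq2',
      mul_comm (q ^ (-2 : ℤ)), one_smul, mul_assoc]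
    abel
  obtain ⟨s, hs, hys, hys'⟩ : ∃ s : ℂ, s ≠ 0 ∧ qShift q y * qShift q (-y) = s • 1 ∧
      qShift q (-y) * qShift q y = s • 1 := by
    refine ⟨q ^ twist y (-y), zpow_ne_zero _ hq, ?_, ?_⟩
    · rw [qShift_mul hq, add_neg_cancel, qShift_zero]
    · rw [qShift_mul hq, neg_add_cancel, qShift_zero]
      congr 2
      simp [twist]
      ring
  set Z : Polynomial ℂ := scaleVar (q ^ (-2 : ℤ)) P * Q -
    q ^ (2 : ℤ) • (scaleVar (q ^ (2 : ℤ)) Q * P) with hZ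
  have hzZ : z = s • tauEval q Z := by
    rw [hz, hw, hv, mul_assoc, ← mul_assoc (tauEval q P), tauEval_mul_qShift hq, hy',
      mul_assoc, ← mul_assoc, hys, mul_assoc (qShift q (-y)), ← mul_assoc (tauEval q Q),
      tauEval_mul_qShift hq, hy, mul_assoc (qShift q y), ← mul_assoc (qShift q (-y)), hys', hZ]
    simp only [map_sub, map_smul, map_mul, smul_mul_assoc, one_mul, smul_sub]
    rw [smul_comm s]
  have hcoef (j : Fin 3) (d : ℕ) : s * Z.coeff d * (q ^ α j * (q ^ comm3 tauExp (genExp j)) ^ d -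
      (q ^ α j)⁻¹) = if d = 0 then (q - q⁻¹)⁻¹ * (q ^ α j - (q ^ α j)⁻¹) else 0 := by
    have h := hzρ (Xg q 3 j)
    rw [hk, QSpace.algEquiv_symm_Xg (zpow_ne_zero _ hq) (hk j), map_smul, map_smul, hzZ,
      regRep_Xg] at h
    simp only [smul_mul_assoc, mul_smul_comm, tauEval_mul_qShift hq] at h
    have h1 : qShift q (genExp j) * tauEval q
        (q ^ α j • s • scaleVar (q ^ comm3 tauExp (genExp j)) Z - (q ^ α j)⁻¹ • s • Z) =
        qShift q (genExp j) * tauEval q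
          (Polynomial.C ((q - q⁻¹)⁻¹ * (q ^ α j - (q ^ α j)⁻¹))) := by
      rw [tauEval, Polynomial.aeval_C, Algebra.algebraMap_eq_smul_one, mul_smul_comm, mul_one,
        ← tauEval]
      simp only [map_sub, map_smul, mul_sub, mul_smul_comm]
      rw [← sub_eq_zero] at h ⊢
      rw [← h]
      module
    have h2 := congrArg (fun P => Polynomial.coeff P d)
      (tauEval_injective hq ((qShift_isUnit hq _).mul_left_cancel h1))
    simp only [Polynomial.coeff_sub, Polynomial.coeff_smul, scaleVar_coeff, smul_eq_mul,
      Polynomial.coeff_C] at h2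
    rw [← h2]
    ring
  have hsq (n : ℤ) (h : q ^ n = (q ^ n)⁻¹) : n = 0 := by
    have : q ^ (n + n) = 1 := by
      rw [zpow_add₀ hq]; nth_rw 1 [h]; exact inv_mul_cancel₀ (zpow_ne_zero _ hq)
    have := hq' _ this
    omega
  have hZ0 : Z ≠ 0 := by
    intro h0
    obtain ⟨j, hj⟩ := hα
    have h := hcoef j 0
    rw [h0, Polynomial.coeff_zero, mul_zero, zero_mul, if_pos rfl, eq_comm,
      mul_eq_zero, or_iff_right (inv_ne_zero hqq), sub_eq_zero] at h
    exact hj (hsq _ h)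
  have hP : P ≠ 0 := by
    rintro rfl
    exact hZ0 (by simp [hZ, scaleVar])
  have hQ : Q ≠ 0 := by
    rintro rfl
    exact hZ0 (by simp [hZ, scaleVar])
  have hZd (d : ℕ) (hd : 0 < d) : Z.coeff d = 0 := by
    obtain ⟨j, hj⟩ := hne d hd
    have h := hcoef j d
    rw [if_neg hd.ne', mul_eq_zero, mul_eq_zero, or_iff_right hs] at h
    refine h.resolve_right fun h => hj (hq' _ ?_)
    rw [sub_eq_zero] at h
    rw [two_mul, add_assoc, zpow_add₀ hq, zpow_add₀ hq, mul_comm (d : ℤ), zpow_mul, zpow_natCast,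
      h, mul_inv_cancel₀ (zpow_ne_zero _ hq)]
  have htop := hZd (P.natDegree + Q.natDegree)
  have h1 : (scaleVar (q ^ (-2 : ℤ)) P * Q).coeff (P.natDegree + Q.natDegree) =
      P.leadingCoeff * (q ^ (-2 : ℤ)) ^ P.natDegree * Q.leadingCoeff := by
    have h := Polynomial.coeff_mul_degree_add_degree (scaleVar (q ^ (-2 : ℤ)) P) Q
    rw [natDegree_scaleVar (zpow_ne_zero (-2) hq)] at h
    rw [h, Polynomial.leadingCoeff, natDegree_scaleVar (zpow_ne_zero (-2) hq), scaleVar_coeff]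
    rfl
  have h2 : (scaleVar (q ^ (2 : ℤ)) Q * P).coeff (P.natDegree + Q.natDegree) =
      Q.leadingCoeff * (q ^ (2 : ℤ)) ^ Q.natDegree * P.leadingCoeff := by
    have h := Polynomial.coeff_mul_degree_add_degree (scaleVar (q ^ (2 : ℤ)) Q) P
    rw [natDegree_scaleVar hq2] at h
    rw [add_comm, h, Polynomial.leadingCoeff, natDegree_scaleVar hq2, scaleVar_coeff]
    rfl
  have hdeg : P.natDegree + Q.natDegree = 0 := by
    by_contra hne0
    have h := htop (Nat.pos_of_ne_zero hne0)
    rw [hZ, Polynomial.coeff_sub, Polynomial.coeff_smul, h1, h2, smul_eq_mul] at h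
    have h3 : (P.leadingCoeff * Q.leadingCoeff) *
        ((q ^ (-2 : ℤ)) ^ P.natDegree - q ^ (2 : ℤ) * (q ^ (2 : ℤ)) ^ Q.natDegree) = 0 := by
      linear_combination h
    rw [mul_eq_zero, or_iff_right (mul_ne_zero (Polynomial.leadingCoeff_ne_zero.2 hP)
      (Polynomial.leadingCoeff_ne_zero.2 hQ)), sub_eq_zero, ← zpow_natCast, ← zpow_natCast,
      ← zpow_mul, ← zpow_mul, ← zpow_add₀ hq] at h3
    have h4 := hq' (2 + 2 * (Q.natDegree : ℤ) - -2 * (P.natDegree : ℤ))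
      (by rw [zpow_sub₀ hq, h3, div_self (zpow_ne_zero _ hq)])
    omega
  exact ⟨_, _, Polynomial.eq_C_of_natDegree_eq_zero (by omega),
    Polynomial.eq_C_of_natDegree_eq_zero (by omega)⟩

theorem KCond16.k_Xg {q : ℂ} {π : UqslMA q 2 (QSpace q 3)} (h : KCond16 q π) (l : Fin 2)
    (j : Fin 3) : π.k l (Xg q 3 j) = q ^ lwt l (genExp j) • Xg q 3 j := by
  obtain ⟨h1, h2, h3, h4, h5, h6⟩ := h
  simp only [Z1, Z2, Z3] at *
  fin_cases l <;> fin_cases j <;> simp [lwt, genExp, *]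

/-- The values of `e_i` and `f_i` on generators, up to one scalar each. -/
theorem KCond16.exists_scalars {q : ℂ} (hq : q ≠ 0) (hq' : ∀ n : ℤ, q ^ n = 1 → n = 0)
    {π : UqslMA q 2 (QSpace q 3)} (h : KCond16 q π) (i : Fin 2) :
    ∃ p r : ℂ,
      (∀ j, regRep hq (π.e i (Xg q 3 j)) =
        (p * (q ^ (lwt i (genExp j) + comm3 (rootExp i) (genExp j)) - 1) *
          q ^ twist (genExp j) (rootExp i)) • qShift q (genExp j + rootExp i)) ∧
      (∀ j, regRep hq (π.f i (Xg q 3 j)) =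
        (q ^ (2 - lwt i (genExp j)) *
          (r * (q ^ (lwt i (genExp j) + comm3 (-rootExp i) (genExp j)) - 1) *
            q ^ twist (genExp j) (-rootExp i))) • qShift q (genExp j + -rootExp i)) := by
  have hk := h.k_Xg
  have hke (l : Fin 2) (a : QSpace q 3) :
      π.k l (π.e i a) = q ^ cartan 2 l i • π.e i (π.k l a) := by
    rw [← π.ke, AlgEquiv.symm_apply_apply]
  have hkf (l : Fin 2) (a : QSpace q 3) :
      π.k l (π.f i a) = q ^ (-cartan 2 l i) • π.f i (π.k l a) := by
    rw [← π.kf, AlgEquiv.symm_apply_apply]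
  obtain ⟨P, hP⟩ := exists_inner_of_weight hq hq' hk (i := i) (π.e_mul i) (y := rootExp i)
    (by fin_cases i <;> simp [rootExp])
    (fun l j => by
      rw [hke, hk, map_smul, smul_smul, ← zpow_add₀ hq, lwt_add, lwt_rootExp, add_comm])
    (fun d => by
      fin_cases i
      · exact ⟨2, by simp [lwt, genExp, comm3, tauExp, twist, rootExp]; omega⟩
      · exact ⟨1, by simp [lwt, genExp, comm3, tauExp, twist, rootExp]; omega⟩)
  obtain ⟨Q, hQ⟩ := exists_inner_of_weight hq hq' hk (i := i)
    (E := (π.k i).toLinearMap ∘ₗ π.f i) (y := -rootExp i)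
    (fun a b => by simp [π.f_mul])
    (by fin_cases i <;> simp [rootExp])
    (fun l j => by
      have hneg : lwt l (-rootExp i) = -lwt l (rootExp i) := by
        simp only [lwt, Prod.fst_neg, Prod.snd_neg]
        fin_cases l <;> simp <;> ring
      simp only [LinearMap.comp_apply, AlgEquiv.toLinearMap_apply]
      rw [π.k_comm, hkf, hk, map_smul, map_smul, map_smul, smul_smul, ← zpow_add₀ hq, lwt_add,
        hneg, lwt_rootExp, add_comm])
    (fun d => by
      rcases Nat.eq_zero_or_pos d with rfl | hd
      · fin_cases i
        · exact ⟨1, by simp [lwt, genExp, comm3, tauExp, twist, rootExp]⟩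
        · exact ⟨0, by simp [lwt, genExp, comm3, tauExp, twist, rootExp]⟩
      · exact ⟨0, by
          fin_cases i <;> simp [lwt, genExp, comm3, tauExp, twist, rootExp] <;> omega⟩)
  have hii : cartan 2 i i = 2 := by simp [cartan]
  obtain ⟨p, r, rfl, rfl⟩ := eq_C_of_commutator hq hq' (hk i) (e := π.e i) (f := π.f i)
    (y := rootExp i) (by fin_cases i <;> simp [comm3, tauExp, twist, rootExp])
    (by fin_cases i <;> simp [comm3, tauExp, twist, rootExp])
    ⟨1, by fin_cases i <;> simp [lwt, genExp]⟩
    (fun d hd => ⟨0, by fin_cases i <;> simp [lwt, genExp, comm3, tauExp, twist] <;> omega⟩)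
    hP hQ (fun a => by rw [π.ke, hii]) (fun a => by rw [π.kf, hii])
    (fun a => by rw [π.ef, if_pos rfl])
  have key (p : ℂ) (y : ℤ × ℤ × ℤ) (j : Fin 3) :
      qShift q y * tauEval q (Polynomial.C p) * regRep hq (π.k i (Xg q 3 j)) -
        regRep hq (Xg q 3 j) * (qShift q y * tauEval q (Polynomial.C p)) =
      (p * (q ^ (lwt i (genExp j) + comm3 y (genExp j)) - 1) *
          q ^ twist (genExp j) y) • qShift q (genExp j + y) := by
    rw [hk, map_smul, regRep_Xg, tauEval, Polynomial.aeval_C, Algebra.algebraMap_eq_smul_one]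
    simp only [mul_smul_comm, smul_mul_assoc, mul_one]
    rw [qShift_comm3 hq, qShift_mul hq, zpow_add₀ hq]
    module
  refine ⟨p, r, fun j => by rw [hP, key], fun j => ?_⟩
  have h1 := hQ (Xg q 3 j)
  rw [key, LinearMap.comp_apply, AlgEquiv.toLinearMap_apply, hkf, hk, map_smul (π.f i), smul_smul,
    ← zpow_add₀ hq, hii, map_smul] at h1
  rw [mul_smul, ← h1, smul_smul, ← zpow_add₀ hq]
  have : 2 - lwt i (genExp j) + (-2 + lwt i (genExp j)) = 0 := by ring
  rw [this, zpow_zero, one_smul]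

theorem Xg_ne_zero {q : ℂ} (hq : q ≠ 0) (j : Fin 3) : Xg q 3 j ≠ 0 := by
  intro h
  have := congrArg (regRep hq) h
  rw [regRep_Xg, map_zero] at this
  exact (qShift_isUnit hq (genExp j)).ne_zero this

theorem KCond16.exists_EFDesc16 {q : ℂ} (hq : q ≠ 0) (hq' : ∀ n : ℤ, q ^ n = 1 → n = 0)
    {π : UqslMA q 2 (QSpace q 3)} (h : KCond16 q π) :
    ∃ b₃ b₀ : ℂ, b₃ ≠ 0 ∧ b₀ ≠ 0 ∧ EFDesc16 q π b₃ b₀ := by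
  have hqq := sub_inv_ne_zero hq hq'
  have hX (u : QSpace q 3) (c c' : ℂ) (n : ℤ × ℤ × ℤ) (m : ℕ × ℕ × ℕ)
      (hu : regRep hq u = c • qShift q n) (hm : n = latExp m) (hc : c = c') :
      u = c' • qMono q m :=
    regRep_injective hq (by rw [hu, map_smul, regRep_qMono, hm, hc])
  obtain ⟨p, r, he, hf⟩ := h.exists_scalars hq hq' 0
  obtain ⟨p', r', he', hf'⟩ := h.exists_scalars hq hq' 1
  have e01 : π.e 0 (Z1 q) = 0 := regRep_injective hq <| by
    rw [Z1, he]; simp [lwt, genExp, comm3, twist, rootExp]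
  have e02 : π.e 0 (Z2 q) = 0 := regRep_injective hq <| by
    rw [Z2, he]; simp [lwt, genExp, comm3, twist, rootExp]
  have f01 : π.f 0 (Z1 q) = 0 := regRep_injective hq <| by
    rw [Z1, hf]; simp [lwt, genExp, comm3, twist, rootExp]
  have f03 : π.f 0 (Z3 q) = 0 := regRep_injective hq <| by
    rw [Z3, hf]; simp [lwt, genExp, comm3, twist, rootExp]
  have e11 : π.e 1 (Z1 q) = 0 := regRep_injective hq <| by
    rw [Z1, he']; simp [lwt, genExp, comm3, twist, rootExp]
  have e13 : π.e 1 (Z3 q) = 0 := regRep_injective hq <| by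
    rw [Z3, he']; simp [lwt, genExp, comm3, twist, rootExp]
  have m1 : qMono q (0, 0, 0) = 1 := by simp [qMono]
  have m2 : qMono q (0, 1, 0) = Z2 q := by simp [qMono, Z2]
  have m3 : qMono q (0, 0, 1) = Z3 q := by simp [qMono, Z3]
  have m12 : qMono q (1, 1, 0) = Z1 q * Z2 q := by simp [qMono, Z1, Z2]
  have m22 : qMono q (0, 2, 0) = Z2 q ^ 2 := by simp [qMono, Z2]
  have m23 : qMono q (0, 1, 1) = Z2 q * Z3 q := by simp [qMono, Z2, Z3]
  obtain ⟨b₃, e03⟩ : ∃ b₃ : ℂ, π.e 0 (Z3 q) = b₃ • Z2 q :=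
    ⟨_, m2 ▸ hX _ _ _ _ (0, 1, 0) (he 2) (by simp [genExp, rootExp, latExp]) rfl⟩
  obtain ⟨b₀, e12⟩ : ∃ b₀ : ℂ, π.e 1 (Z2 q) = b₀ • 1 :=
    ⟨_, m1 ▸ hX _ _ _ _ (0, 0, 0) (he' 1) (by simp [genExp, rootExp, latExp]) rfl⟩
  obtain ⟨c, f02⟩ : ∃ c : ℂ, π.f 0 (Z2 q) = c • Z3 q :=
    ⟨_, m3 ▸ hX _ _ _ _ (0, 0, 1) (hf 1) (by simp [genExp, rootExp, latExp]) rfl⟩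
  obtain ⟨c', f11, f12, f13⟩ : ∃ c' : ℂ, π.f 1 (Z1 q) = c' • (Z1 q * Z2 q) ∧
      π.f 1 (Z2 q) = (-q * c') • (Z2 q ^ 2) ∧ π.f 1 (Z3 q) = (-q * c') • (Z2 q * Z3 q) := by
    rw [← m12, ← m22, ← m23]
    refine ⟨q * (r' * (q ^ 2 - 1)),
      hX _ _ _ _ _ (hf' 0) (by simp [genExp, rootExp, latExp]) ?_,
      hX _ _ _ _ _ (hf' 1) (by simp [genExp, rootExp, latExp]) ?_,
      hX _ _ _ _ _ (hf' 2) (by simp [genExp, rootExp, latExp]) ?_⟩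
    · simp [lwt, genExp, comm3, twist, rootExp]
    · simp [lwt, genExp, comm3, twist, rootExp]
      norm_cast
      field_simp
      ring
    · simp [lwt, genExp, comm3, twist, rootExp]
      norm_cast
      field_simp
      ring
  obtain ⟨hk1, hk2, hk3, hk4, hk5, hk6⟩ := h
  have hc : b₃ * c = 1 := by
    have h1 := π.ef 0 0 (Z3 q)
    rw [if_pos rfl, f03, map_zero, e03, map_smul, f02, hk3, Z3,
      QSpace.algEquiv_symm_Xg (inv_ne_zero hq) hk3, zero_sub, inv_inv] at h1
    have h2 : (-(b₃ * c)) = (q - q⁻¹)⁻¹ * (q⁻¹ - q) :=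
      smul_left_injective ℂ (Xg_ne_zero hq 2) <| by
        linear_combination (norm := module) h1
    have h3 : (q - q⁻¹)⁻¹ * (q⁻¹ - q) = -1 := by
      rw [← neg_sub q, mul_neg, inv_mul_cancel₀ hqq]
    rw [h3] at h2
    exact neg_injective h2
  have hc' : b₀ * c' = 1 := by
    have h1 := π.ef 1 1 (Z1 q)
    rw [if_pos rfl, e11, map_zero, f11, map_smul, π.e_mul, e11, e12, hk4, Z1,
      QSpace.algEquiv_symm_Xg hq hk4, zero_mul, add_zero, mul_smul_comm, mul_one, sub_zero] at h1
    rw [mul_comm, ← inv_mul_cancel₀ hqq]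
    exact smul_left_injective ℂ (Xg_ne_zero hq 0) <| by
      linear_combination (norm := module) h1
  obtain rfl : c = b₃⁻¹ := (inv_eq_of_mul_eq_one_right hc).symm
  obtain rfl : c' = b₀⁻¹ := (inv_eq_of_mul_eq_one_right hc').symm
  exact ⟨b₃, b₀, left_ne_zero_of_mul_eq_one hc, left_ne_zero_of_mul_eq_one hc',
    e01, e02, e03, e11, e12, e13, f01, f02, f03, f11, f12, f13⟩

section Leibniz

variable {A : Type*} [Ring A] [Algebra ℂ A] {q : ℂ} (hq : q ≠ 0)
include hq

/-- The quantum Serre expression of two right-twisted derivations is a twisted derivation. -/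
theorem serre_mul_right {k k' : A ≃ₐ[ℂ] A} {e e' : A →ₗ[ℂ] A} (hk : ∀ a, k (k' a) = k' (k a))
    (he : ∀ a b, e (a * b) = a * e b + e a * k b)
    (he' : ∀ a b, e' (a * b) = a * e' b + e' a * k' b)
    (hke : ∀ a, k (e a) = q ^ 2 • e (k a)) (hke' : ∀ a, k (e' a) = q⁻¹ • e' (k a))
    (hk'e : ∀ a, k' (e a) = q⁻¹ • e (k' a)) (a b : A) :
    (e (e (e' (a * b))) - (q + q⁻¹) • e (e' (e (a * b))) + e' (e (e (a * b)))) =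
      a * (e (e (e' b)) - (q + q⁻¹) • e (e' (e b)) + e' (e (e b))) +
      (e (e (e' a)) - (q + q⁻¹) • e (e' (e a)) + e' (e (e a))) * k (k (k' b)) := by
  simp only [he, he', map_add, map_smul, hke, hke', hk'e, hk, mul_add, add_mul, mul_sub, sub_mul,
    mul_smul_comm, smul_mul_assoc, smul_add, smul_smul]
  match_scalars <;> field_simp <;> ring

/-- The quantum Serre expression of two left-twisted derivations is a twisted derivation. -/
theorem serre_mul_left {k k' : A ≃ₐ[ℂ] A} {f f' : A →ₗ[ℂ] A} (hk : ∀ a, k (k' a) = k' (k a))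
    (hf : ∀ a b, f (a * b) = k a * f b + f a * b)
    (hf' : ∀ a b, f' (a * b) = k' a * f' b + f' a * b)
    (hkf : ∀ a, k (f a) = q ^ 2 • f (k a)) (hkf' : ∀ a, k (f' a) = q⁻¹ • f' (k a))
    (hk'f : ∀ a, k' (f a) = q⁻¹ • f (k' a)) (a b : A) :
    (f (f (f' (a * b))) - (q + q⁻¹) • f (f' (f (a * b))) + f' (f (f (a * b)))) =
      k (k (k' a)) * (f (f (f' b)) - (q + q⁻¹) • f (f' (f b)) + f' (f (f b))) +
      (f (f (f' a)) - (q + q⁻¹) • f (f' (f a)) + f' (f (f a))) * b := by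
  simp only [hf, hf', map_add, map_smul, hkf, hkf', hk'f, hk, mul_add, add_mul, mul_sub, sub_mul,
    mul_smul_comm, smul_mul_assoc, smul_add, smul_smul]
  match_scalars <;> field_simp <;> ring

end Leibniz

theorem commutator_mul {A : Type*} [Ring A] [Algebra ℂ A] {k k' : A ≃ₐ[ℂ] A} {e f : A →ₗ[ℂ] A}
    {c : ℂ} (he : ∀ a b, e (a * b) = a * e b + e a * k b)
    (hf : ∀ a b, f (a * b) = k'.symm a * f b + f a * b)
    (hke : ∀ a, k'.symm (e a) = c • e (k'.symm a)) (hkf : ∀ a, k (f a) = c • f (k a)) (a b : A) :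
    e (f (a * b)) - f (e (a * b)) =
      k'.symm a * (e (f b) - f (e b)) + (e (f a) - f (e a)) * k b := by
  simp only [he, hf, map_add, hke, hkf, mul_sub, sub_mul, mul_smul_comm, smul_mul_assoc]
  abel

theorem cartan_self {m : ℕ} (i : Fin m) : cartan m i i = 2 := if_pos rfl

theorem cartan_comm {m : ℕ} (i j : Fin m) : cartan m i j = cartan m j i := by
  simp only [cartan, eq_comm (a := i)]
  rw [← Int.natAbs_neg, neg_sub]

/-- Twisted derivations with diagonal `k`s define a module-algebra structure as soon as the
relations hold on generators. -/
theorem exists_UqslMA_of_generators {q : ℂ} (hq : q ≠ 0) {n m : ℕ}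
    (k : Fin m → (QSpace q n ≃ₐ[ℂ] QSpace q n)) (e f : Fin m → (QSpace q n →ₗ[ℂ] QSpace q n))
    {α : Fin m → Fin n → ℤ} (hk : ∀ l s, k l (Xg q n s) = q ^ α l s • Xg q n s)
    (e_mul : ∀ i a b, e i (a * b) = a * e i b + e i a * k i b)
    (f_mul : ∀ i a b, f i (a * b) = (k i).symm a * f i b + f i a * b)
    (hke : ∀ i j s, k i (e j (Xg q n s)) = q ^ (cartan m i j + α i s) • e j (Xg q n s))
    (hkf : ∀ i j s, k i (f j (Xg q n s)) = q ^ (-cartan m i j + α i s) • f j (Xg q n s))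
    (hef : ∀ i j s, e i (f j (Xg q n s)) - f j (e i (Xg q n s)) =
      if i = j then ((q - q⁻¹)⁻¹ * (q ^ α i s - (q ^ α i s)⁻¹)) • Xg q n s else 0)
    (hee : ∀ i j, cartan m i j ≠ 0)
    (hse : ∀ i j, cartan m i j = -1 → ∀ s, e i (e i (e j (Xg q n s))) -
      (q + q⁻¹) • e i (e j (e i (Xg q n s))) + e j (e i (e i (Xg q n s))) = 0)
    (hsf : ∀ i j, cartan m i j = -1 → ∀ s, f i (f i (f j (Xg q n s))) -
      (q + q⁻¹) • f i (f j (f i (Xg q n s))) + f j (f i (f i (Xg q n s))) = 0) :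
    ∃ π : UqslMA q m (QSpace q n), π.k = k ∧ π.e = e ∧ π.f = f := by
  have e_one (i) : e i 1 = 0 := by simpa using e_mul i 1 1
  have f_one (i) : f i 1 = 0 := by simpa using f_mul i 1 1
  have k_comm (i j a) : k i (k j a) = k j (k i a) :=
    QSpace.algHom_eq (φ := (k i).toAlgHom.comp (k j).toAlgHom)
      (ψ := (k j).toAlgHom.comp (k i).toAlgHom)
      (fun s => by simp [hk, smul_smul, mul_comm]) a
  have ke (i j a) : k i (e j a) = q ^ cartan m i j • e j (k i a) :=
    QSpace.twistedDerivation_eq (g := k i) (h := fun a => k i (k j a))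
      (D := (k i).toLinearMap ∘ₗ e j) (D' := q ^ cartan m i j • e j ∘ₗ (k i).toLinearMap)
      (fun a b => by simp [e_mul]) (fun a b => by simp [e_mul, k_comm i j])
      (by simp [e_one]) (fun s => by simp [hke, hk, smul_smul, zpow_add₀ hq]) a
  have kf (i j a) : k i (f j a) = q ^ (-cartan m i j) • f j (k i a) :=
    QSpace.twistedDerivation_eq (g := fun a => k i ((k j).symm a)) (h := k i)
      (D := (k i).toLinearMap ∘ₗ f j) (D' := q ^ (-cartan m i j) • f j ∘ₗ (k i).toLinearMap)
      (fun a b => by simp [f_mul])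
      (fun a b => by
        have : (k j).symm (k i a) = k i ((k j).symm a) := by
          rw [AlgEquiv.symm_apply_eq, k_comm, AlgEquiv.apply_symm_apply]
        simp [f_mul, this])
      (by simp [f_one]) (fun s => by
        simp only [LinearMap.comp_apply, AlgEquiv.toLinearMap_apply, hkf, LinearMap.smul_apply, hk,
          map_smul, smul_smul, zpow_add₀ hq]) a
  have ke' (i j a) : (k i).symm (e j a) = q ^ (-cartan m i j) • e j ((k i).symm a) := by
    rw [AlgEquiv.symm_apply_eq, map_smul, ke, AlgEquiv.apply_symm_apply, smul_smul,
      ← zpow_add₀ hq, neg_add_cancel, zpow_zero, one_smul]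
  have kf' (i j a) : (k i).symm (f j a) = q ^ cartan m i j • f j ((k i).symm a) := by
    rw [AlgEquiv.symm_apply_eq, map_smul, kf, AlgEquiv.apply_symm_apply, smul_smul,
      ← zpow_add₀ hq, add_neg_cancel, zpow_zero, one_smul]
  have k_comm' (i j a) : (k i).symm ((k j).symm a) = (k j).symm ((k i).symm a) := by
    rw [AlgEquiv.symm_apply_eq, AlgEquiv.symm_apply_eq, k_comm, AlgEquiv.apply_symm_apply,
      AlgEquiv.apply_symm_apply]
  refine ⟨{
    k := k, e := e, f := f, e_mul := e_mul, f_mul := f_mul, e_one := e_one, f_one := f_one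
    k_comm := k_comm
    ke := fun i j a => by rw [ke, AlgEquiv.apply_symm_apply]
    kf := fun i j a => by rw [kf, AlgEquiv.apply_symm_apply]
    ef := fun i j a => ?_
    ee_comm := fun i j h => absurd h (hee i j)
    ff_comm := fun i j h => absurd h (hee i j)
    serre_e := fun i j hij a => ?_
    serre_f := fun i j hij a => ?_ }, rfl, rfl, rfl⟩
  · have hmul := commutator_mul (e_mul i) (f_mul j) (ke' j i)
      (fun a => by rw [cartan_comm]; exact kf i j a)
    split_ifs with h
    · subst h
      refine QSpace.twistedDerivation_eq (D := e i ∘ₗ f i - f i ∘ₗ e i)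
        (D' := (q - q⁻¹)⁻¹ • ((k i).toLinearMap - (k i).symm.toLinearMap))
        hmul (fun a b => ?_) ?_ (fun s => ?_) a
      · simp [mul_sub, sub_mul, smul_sub]
      · simp [e_one, f_one]
      · have := hef i i s
        rw [if_pos rfl] at this
        simp only [LinearMap.sub_apply, LinearMap.comp_apply, this, LinearMap.smul_apply,
          AlgEquiv.toLinearMap_apply, hk, QSpace.algEquiv_symm_Xg (zpow_ne_zero _ hq) (hk i s)]
        module
    · refine QSpace.twistedDerivation_eq (D := e i ∘ₗ f j - f j ∘ₗ e i) (D' := 0)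
        hmul (by simp) (by simp [e_one, f_one]) (fun s => ?_) a
      simpa [h] using hef i j s
  · have hji : cartan m j i = -1 := by rw [cartan_comm, hij]
    exact QSpace.twistedDerivation_eq (g := id) (h := fun b => k i (k i (k j b)))
      (D := e i ∘ₗ e i ∘ₗ e j - (q + q⁻¹) • e i ∘ₗ e j ∘ₗ e i + e j ∘ₗ e i ∘ₗ e i) (D' := 0)
      (serre_mul_right hq (k_comm i j) (e_mul i) (e_mul j)
        (fun a => by rw [ke, cartan_self]; rfl)
        (fun a => by rw [ke, hij, zpow_neg_one]) (fun a => by rw [ke, hji, zpow_neg_one]))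
      (by simp) (by simp [e_one]) (hse i j hij) a
  · have hji : cartan m j i = -1 := by rw [cartan_comm, hij]
    exact QSpace.twistedDerivation_eq
      (g := fun b => (k i).symm ((k i).symm ((k j).symm b))) (h := id)
      (D := f i ∘ₗ f i ∘ₗ f j - (q + q⁻¹) • f i ∘ₗ f j ∘ₗ f i + f j ∘ₗ f i ∘ₗ f i) (D' := 0)
      (serre_mul_left hq (k_comm' i j) (f_mul i) (f_mul j)
        (fun a => by rw [kf', cartan_self]; rfl)
        (fun a => by rw [kf', hij, zpow_neg_one]) (fun a => by rw [kf', hji, zpow_neg_one]))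
      (by simp) (by simp [f_one]) (hsf i j hij) a

set_option maxHeartbeats 1000000 in
/-- The module-algebra structure with given parameters exists. -/
theorem exists_UqslMA_EFDesc16 {q : ℂ} (hq : q ≠ 0) (hqq : q - q⁻¹ ≠ 0) {b₃ b₀ : ℂ}
    (h₃ : b₃ ≠ 0) (h₀ : b₀ ≠ 0) :
    ∃ π : UqslMA q 2 (QSpace q 3), KCond16 q π ∧ EFDesc16 q π b₃ b₀ := by
  have hqq' : q ^ 2 - 1 ≠ 0 := by
    contrapose! hqq
    field_simp
    rw [hqq, mul_zero]
  let k (l : Fin 2) : QSpace q 3 ≃ₐ[ℂ] QSpace q 3 :=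
    QSpace.diag (fun j => q ^ lwt l (genExp j)) fun j => zpow_ne_zero _ hq
  have hk (l j) : k l (Xg q 3 j) = q ^ lwt l (genExp j) • Xg q 3 j := QSpace.diag_Xg _ _ j
  have hks (l j) : (k l).symm (Xg q 3 j) = (q ^ lwt l (genExp j))⁻¹ • Xg q 3 j :=
    QSpace.algEquiv_symm_Xg (zpow_ne_zero _ hq) (hk l j)
  have r10 := QSpace.Xg_mul_Xg (q := q) (n := 3) (i := 1) (j := 0) (by decide)
  have r20 := QSpace.Xg_mul_Xg (q := q) (n := 3) (i := 2) (j := 0) (by decide)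
  have r21 := QSpace.Xg_mul_Xg (q := q) (n := 3) (i := 2) (j := 1) (by decide)
  have assoc {x y : QSpace q 3} (h : x * y = q • (y * x)) (z : QSpace q 3) :
      x * (y * z) = q • (y * (x * z)) := by
    rw [← mul_assoc, h, smul_mul_assoc, mul_assoc]
  have r10' := assoc r10
  have r20' := assoc r20
  have r21' := assoc r21
  let u : Fin 2 → Fin 3 → QSpace q 3 := ![![0, 0, b₃ • Xg q 3 1], ![0, b₀ • 1, 0]]
  let v : Fin 2 → Fin 3 → QSpace q 3 := ![![0, b₃⁻¹ • Xg q 3 2, 0],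
    ![b₀⁻¹ • (Xg q 3 0 * Xg q 3 1), (-q * b₀⁻¹) • (Xg q 3 1 * Xg q 3 1),
      (-q * b₀⁻¹) • (Xg q 3 1 * Xg q 3 2)]]
  have he (i : Fin 2) := QSpace.exists_twistedDerivation (AlgHom.id ℂ (QSpace q 3)) (k i).toAlgHom
    (u i) (by
      intro s t hst
      fin_cases i <;> fin_cases s <;> fin_cases t <;> simp at hst <;>
      simp [u, hk, lwt, genExp, r10, smul_smul] <;>
      match_scalars <;> field_simp)
  have hf (i : Fin 2) := QSpace.exists_twistedDerivation (k i).symm.toAlgHom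
    (AlgHom.id ℂ (QSpace q 3)) (v i) (by
      intro s t hst
      fin_cases i <;> fin_cases s <;> fin_cases t <;> simp at hst <;>
      simp [v, hks, lwt, genExp, r10, r20, r21, r10', r20', r21', smul_smul, mul_assoc] <;>
      match_scalars <;> field_simp <;> ring)
  choose e e_mul he using he
  choose f f_mul hf using hf
  replace e_mul (i a b) : e i (a * b) = a * e i b + e i a * k i b := e_mul i a b
  replace f_mul (i a b) : f i (a * b) = (k i).symm a * f i b + f i a * b := f_mul i a b
  have e_one (i) : e i 1 = 0 := by simpa using e_mul i 1 1
  have f_one (i) : f i 1 = 0 := by simpa using f_mul i 1 1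
  obtain ⟨π, hπk, hπe, hπf⟩ := exists_UqslMA_of_generators hq k e f hk e_mul f_mul
    (fun i j s => by
      fin_cases i <;> fin_cases j <;> fin_cases s <;>
      simp [he, u, hk, lwt, genExp, cartan] <;>
      match_scalars <;> field_simp)
    (fun i j s => by
      fin_cases i <;> fin_cases j <;> fin_cases s <;>
      simp [hf, v, hk, lwt, genExp, cartan] <;>
      match_scalars <;> field_simp)
    (fun i j s => by
      fin_cases i <;> fin_cases j <;> fin_cases s <;>
      simp [he, hf, u, v, hk, e_mul, lwt, genExp, f_one, smul_smul] <;>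
      match_scalars <;> field_simp <;> ring)
    (fun i j => by fin_cases i <;> fin_cases j <;> simp [cartan])
    (fun i j hij s => by
      fin_cases i <;> fin_cases j <;> fin_cases s <;> simp [cartan] at hij <;>
      simp [he, u, e_one])
    (fun i j hij s => by
      fin_cases i <;> fin_cases j <;> fin_cases s <;> simp [cartan] at hij <;>
      simp [hf, v, hks, f_mul, lwt, genExp, r21, r21', mul_assoc, mul_add, add_mul, smul_smul] <;>
      match_scalars <;> field_simp <;> ring)
  refine ⟨π, ?_, ?_⟩
  · simp [KCond16, hπk, Z1, Z2, Z3, hk, lwt, genExp]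
  · simp [EFDesc16, hπe, hπf, Z1, Z2, Z3, he, hf, u, v, pow_two]

/-- Every structure with nonzero parameters is isomorphic, through a diagonal automorphism, to
the one whose parameters are both one. -/
theorem iso_of_EFDesc16 {q : ℂ} {π π' : UqslMA q 2 (QSpace q 3)} {b₃ b₀ : ℂ}
    (h₃ : b₃ ≠ 0) (h₀ : b₀ ≠ 0) (hπ : KCond16 q π) (hπ' : KCond16 q π')
    (hd : EFDesc16 q π b₃ b₀) (hd' : EFDesc16 q π' 1 1) : π.Iso π' := by
  let c : Fin 3 → ℂ := ![1, b₀, b₃ * b₀]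
  have hc (j) : c j ≠ 0 := by fin_cases j <;> simp [c, h₃, h₀]
  let ψ : QSpace q 3 ≃ₐ[ℂ] QSpace q 3 := QSpace.diag c hc
  have hψ (j) : ψ (Xg q 3 j) = c j • Xg q 3 j := QSpace.diag_Xg c hc j
  have hkX := hπ.k_Xg
  have hkX' := hπ'.k_Xg
  have hk (i a) : ψ (π.k i a) = π'.k i (ψ a) :=
    QSpace.algHom_eq (φ := ψ.toAlgHom.comp (π.k i).toAlgHom)
      (ψ := (π'.k i).toAlgHom.comp ψ.toAlgHom)
      (fun j => by simp [hkX, hkX', hψ, smul_smul, mul_comm]) a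
  have hks (i a) : ψ ((π.k i).symm a) = (π'.k i).symm (ψ a) := by
    rw [AlgEquiv.eq_symm_apply, ← hk, AlgEquiv.apply_symm_apply]
  obtain ⟨e01, e02, e03, e11, e12, e13, f01, f02, f03, f11, f12, f13⟩ := hd
  obtain ⟨e01', e02', e03', e11', e12', e13', f01', f02', f03', f11', f12', f13'⟩ := hd'
  have he (i a) : ψ (π.e i a) = π'.e i (ψ a) := by
    refine QSpace.twistedDerivation_eq (g := ψ) (h := fun b => ψ (π.k i b))
      (D := ψ.toLinearMap ∘ₗ π.e i) (D' := π'.e i ∘ₗ ψ.toLinearMap)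
      (fun a b => by simp [π.e_mul]) (fun a b => by simp [π'.e_mul, hk])
      (by simp [π.e_one, π'.e_one]) (fun j => ?_) a
    simp only [Z1, Z2, Z3] at *
    fin_cases i <;> fin_cases j <;> simp [*, c, smul_smul]
  have hf (i a) : ψ (π.f i a) = π'.f i (ψ a) := by
    refine QSpace.twistedDerivation_eq (g := fun b => ψ ((π.k i).symm b)) (h := ψ)
      (D := ψ.toLinearMap ∘ₗ π.f i) (D' := π'.f i ∘ₗ ψ.toLinearMap)
      (fun a b => by simp [π.f_mul]) (fun a b => by simp [π'.f_mul, hks])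
      (by simp [π.f_one, π'.f_one]) (fun j => ?_) a
    simp only [Z1, Z2, Z3] at *
    fin_cases i <;> fin_cases j <;> simp [*, c, smul_smul, pow_two] <;>
      match_scalars <;> field_simp
  exact ⟨ψ, fun i a => by rw [hk, AlgEquiv.apply_symm_apply],
    fun i a => by rw [hks, AlgEquiv.apply_symm_apply],
    fun i a => by rw [he, AlgEquiv.apply_symm_apply],
    fun i a => by rw [hf, AlgEquiv.apply_symm_apply]⟩

theorem zpow_eq_one_imp {q : ℂ} (hq' : ∀ N : ℕ, 0 < N → q ^ N ≠ 1) (n : ℤ) (h : q ^ n = 1) :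
    n = 0 := by
  obtain ⟨N, rfl | rfl⟩ := n.eq_nat_or_neg
  · by_contra h0
    exact hq' N (by omega) (by simpa using h)
  · by_contra h0
    exact hq' N (by omega) (by simpa using h)

/-- Classification of `U_q(sl(3))`-module-algebra structures on `A_q(3)` in case
`(A5)|(B6)`: description, converse existence, and isomorphism with the normalized one. -/
theorem Uqsl3_on_Aq3_A5B6 (q : ℂ) (hq : q ≠ 0)
    (hq' : ∀ N : ℕ, 0 < N → q ^ N ≠ 1) :
    (∀ π : UqslMA q 2 (QSpace q 3), KCond16 q π →
      ∃ b₃ b₀ : ℂ, b₃ ≠ 0 ∧ b₀ ≠ 0 ∧ EFDesc16 q π b₃ b₀) ∧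
    (∀ b₃ b₀ : ℂ, b₃ ≠ 0 → b₀ ≠ 0 →
      ∃ π : UqslMA q 2 (QSpace q 3), KCond16 q π ∧ EFDesc16 q π b₃ b₀) ∧
    (∀ π π' : UqslMA q 2 (QSpace q 3),
      KCond16 q π → KCond16 q π' → EFDesc16 q π' 1 1 → π.Iso π') := by
  have hz := zpow_eq_one_imp hq'
  refine ⟨fun π hπ => hπ.exists_EFDesc16 hq hz,
    fun b₃ b₀ h₃ h₀ => exists_UqslMA_EFDesc16 hq (sub_inv_ne_zero hq hz) h₃ h₀,
    fun π π' hπ hπ' hd' => ?_⟩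
  obtain ⟨b₃, b₀, h₃, h₀, hd⟩ := hπ.exists_EFDesc16 hq hz
  exact iso_of_EFDesc16 h₃ h₀ hπ hπ' hd hd'
end
end

section
/- Let (k_1, k_1^{-1}, e_1, f_1, k_2, k_2^{-1}, e_2, f_2) be a module-algebra structure of U_q(sl(3)) on the quantum 3-space A_q(3) with k_1(x_1) = qx_1, k_1(x_2) = q⁻¹x_2, k_1(x_3) = x_3, k_2(x_1) = qx_1, k_2(x_2) = q²x_2, k_2(x_3) = q⁻¹x_3. Then there exist a₂, e₀ ∈ ℂ∖{0} such that e_1(x_2) = a₂x_1, e_1(x_1) = e_1(x_3) = 0, e_2(x_1) = −qe₀⁻¹x_1x_2, e_2(x_2) = −qe₀⁻¹x_2², e_2(x_3) = e₀⁻¹x_2x_3, f_1(x_1) = a₂⁻¹x_2, f_1(x_2) = f_1(x_3) = 0, f_2(x_1) = 0, f_2(x_2) = e₀·1, f_2(x_3) = 0. Conversely, each such assignment defines a module-algebra structure of U_q(sl(3)) on A_q(3), and every such structure is isomorphic to the one with a₂ = e₀ = 1. -/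
noncomputable section

open scoped BigOperators

/-- The `k`-action of case `(A4)|(B7)`. -/
def KCond17 (q : ℂ) (π : UqslMA q 2 (QSpace q 3)) : Prop :=
  π.k 0 (Z1 q) = q • Z1 q ∧ π.k 0 (Z2 q) = q⁻¹ • Z2 q ∧ π.k 0 (Z3 q) = Z3 q ∧
  π.k 1 (Z1 q) = q • Z1 q ∧ π.k 1 (Z2 q) = (q ^ (2 : ℕ)) • Z2 q ∧
  π.k 1 (Z3 q) = q⁻¹ • Z3 q

/-- The `e`/`f`-action of case `(A4)|(B7)` with parameters `a₂`, `e₀`. -/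
def EFDesc17 (q : ℂ) (π : UqslMA q 2 (QSpace q 3)) (a₂ e₀ : ℂ) : Prop :=
  π.e 0 (Z1 q) = 0 ∧ π.e 0 (Z2 q) = a₂ • Z1 q ∧ π.e 0 (Z3 q) = 0 ∧
  π.e 1 (Z1 q) = (-q * e₀⁻¹) • (Z1 q * Z2 q) ∧
  π.e 1 (Z2 q) = (-q * e₀⁻¹) • (Z2 q ^ 2) ∧
  π.e 1 (Z3 q) = e₀⁻¹ • (Z2 q * Z3 q) ∧
  π.f 0 (Z1 q) = a₂⁻¹ • Z2 q ∧ π.f 0 (Z2 q) = 0 ∧ π.f 0 (Z3 q) = 0 ∧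
  π.f 1 (Z1 q) = 0 ∧ π.f 1 (Z2 q) = e₀ • 1 ∧ π.f 1 (Z3 q) = 0

namespace QuantumThreeSpace

open Module

variable {q : ℂ}

/-! ### Generators and relations -/

theorem Xg_mul_Xg (i j : Fin 3) (h : j < i) :
    Xg q 3 i * Xg q 3 j = q • (Xg q 3 j * Xg q 3 i) := by
  simpa [Xg, map_mul, map_smul] using RingQuot.mkAlgHom_rel ℂ (QRel.rel (q := q) i j h)

theorem Z2_mul_Z1 : Z2 q * Z1 q = q • (Z1 q * Z2 q) := Xg_mul_Xg 1 0 (by decide)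
theorem Z3_mul_Z1 : Z3 q * Z1 q = q • (Z1 q * Z3 q) := Xg_mul_Xg 2 0 (by decide)
theorem Z3_mul_Z2 : Z3 q * Z2 q = q • (Z2 q * Z3 q) := Xg_mul_Xg 2 1 (by decide)

/-- The algebra homomorphism out of the quantum 3-space given by the images of the generators. -/
def liftHom {A : Type*} [Ring A] [Algebra ℂ A] (g : Fin 3 → A)
    (h : ∀ i j, j < i → g i * g j = q • (g j * g i)) : QSpace q 3 →ₐ[ℂ] A :=
  RingQuot.liftAlgHom ℂ ⟨FreeAlgebra.lift ℂ g, by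
    rintro _ _ ⟨i, j, hij⟩
    simpa using h i j hij⟩

@[simp]
theorem liftHom_Xg {A : Type*} [Ring A] [Algebra ℂ A] (g : Fin 3 → A)
    (h : ∀ i j, j < i → g i * g j = q • (g j * g i)) (i : Fin 3) :
    liftHom g h (Xg q 3 i) = g i := by
  simp [liftHom, Xg]

theorem algHom_ext {A : Type*} [Ring A] [Algebra ℂ A] {f g : QSpace q 3 →ₐ[ℂ] A}
    (h : ∀ i, f (Xg q 3 i) = g (Xg q 3 i)) : f = g := by
  apply RingQuot.ringQuot_ext'
  apply FreeAlgebra.hom_ext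
  funext i
  exact h i

theorem induction_gen {P : QSpace q 3 → Prop} (hc : ∀ c : ℂ, P (algebraMap ℂ _ c))
    (hX : ∀ i, P (Xg q 3 i)) (hadd : ∀ a b, P a → P b → P (a + b))
    (hmul : ∀ a b, P a → P b → P (a * b)) (a : QSpace q 3) : P a := by
  obtain ⟨a, rfl⟩ := RingQuot.mkAlgHom_surjective ℂ (QRel q 3) a
  induction a using FreeAlgebra.induction with
  | grade0 r => simpa using hc r
  | grade1 x => exact hX x
  | mul a b ha hb => simpa using hmul _ _ ha hb
  | add a b ha hb => simpa using hadd _ _ ha hb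

/-- The automorphism rescaling the generators. -/
def scaleHom (q : ℂ) (t : Fin 3 → ℂ) : QSpace q 3 →ₐ[ℂ] QSpace q 3 :=
  liftHom (fun i => t i • Xg q 3 i) fun i j h => by
    simp only [smul_mul_smul_comm, Xg_mul_Xg i j h]
    rw [smul_comm, mul_comm (t i)]

@[simp]
theorem scaleHom_Xg (t : Fin 3 → ℂ) (i : Fin 3) : scaleHom q t (Xg q 3 i) = t i • Xg q 3 i := by
  simp [scaleHom]

/-- The automorphism rescaling the generators by nonzero scalars. -/
def scale (q : ℂ) (t : Fin 3 → ℂ) (ht : ∀ i, t i ≠ 0) : QSpace q 3 ≃ₐ[ℂ] QSpace q 3 :=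
  AlgEquiv.ofAlgHom (scaleHom q t) (scaleHom q fun i => (t i)⁻¹)
    (algHom_ext fun i => by simp [smul_smul, ht])
    (algHom_ext fun i => by simp [smul_smul, ht])

theorem scale_Xg (t : Fin 3 → ℂ) (ht : ∀ i, t i ≠ 0) (i : Fin 3) :
    scale q t ht (Xg q 3 i) = t i • Xg q 3 i := by
  simp [scale]

/-! ### Monomials -/

/-- The ordered monomial `x₁ᵃ x₂ᵇ x₃ᶜ`. -/
def mon (q : ℂ) (a b c : ℕ) : QSpace q 3 := Z1 q ^ a * Z2 q ^ b * Z3 q ^ c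

theorem pow_mul_pow_of_qcomm {A : Type*} [Ring A] [Algebra ℂ A] {x y : A}
    (h : y * x = q • (x * y)) (m n : ℕ) : y ^ m * x ^ n = q ^ (m * n) • (x ^ n * y ^ m) := by
  have h1 : ∀ n : ℕ, y * x ^ n = q ^ n • (x ^ n * y) := by
    intro n
    induction n with
    | zero => simp
    | succ n ih =>
      rw [pow_succ, ← mul_assoc, ih, smul_mul_assoc, mul_assoc, h, mul_smul_comm, smul_smul,
        mul_assoc, pow_succ]
  induction m with
  | zero => simp
  | succ m ih =>
    rw [pow_succ, mul_assoc, h1, mul_smul_comm, ← mul_assoc, ih, smul_mul_assoc, smul_smul,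
      mul_assoc, ← pow_add]
    congr 2
    ring

theorem mon_mul_mon (a b c a' b' c' : ℕ) :
    mon q a b c * mon q a' b' c' =
      (q ^ (b * a') * q ^ (c * a') * q ^ (c * b')) • mon q (a + a') (b + b') (c + c') := by
  have h21 := pow_mul_pow_of_qcomm (Z2_mul_Z1 (q := q)) b a'
  have h31 := pow_mul_pow_of_qcomm (Z3_mul_Z1 (q := q)) c a'
  have h32 := pow_mul_pow_of_qcomm (Z3_mul_Z2 (q := q)) c b'
  unfold mon
  calc
    _ = Z1 q ^ a * Z2 q ^ b * (Z3 q ^ c * Z1 q ^ a') * Z2 q ^ b' * Z3 q ^ c' := by noncomm_ring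
    _ = q ^ (c * a') •
        (Z1 q ^ a * (Z2 q ^ b * Z1 q ^ a') * (Z3 q ^ c * Z2 q ^ b') * Z3 q ^ c') := by
      rw [h31]; simp only [mul_smul_comm, smul_mul_assoc, mul_assoc]
    _ = (q ^ (b * a') * q ^ (c * a') * q ^ (c * b')) •
        ((Z1 q ^ a * Z1 q ^ a') * (Z2 q ^ b * Z2 q ^ b') * (Z3 q ^ c * Z3 q ^ c')) := by
      rw [h21, h32]
      simp only [mul_smul_comm, smul_mul_assoc, mul_assoc, smul_smul]
      congr 1
      ring
    _ = _ := by simp only [pow_add]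

theorem mon_zero : mon q 0 0 0 = 1 := by simp [mon]
theorem Z1_eq_mon : Z1 q = mon q 1 0 0 := by simp [mon]
theorem Z2_eq_mon : Z2 q = mon q 0 1 0 := by simp [mon]
theorem Z3_eq_mon : Z3 q = mon q 0 0 1 := by simp [mon]

theorem map_mon (k : QSpace q 3 →ₐ[ℂ] QSpace q 3) {t₁ t₂ t₃ : ℂ} (h1 : k (Z1 q) = t₁ • Z1 q)
    (h2 : k (Z2 q) = t₂ • Z2 q) (h3 : k (Z3 q) = t₃ • Z3 q) (a b c : ℕ) :
    k (mon q a b c) = (t₁ ^ a * t₂ ^ b * t₃ ^ c) • mon q a b c := by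
  simp only [mon, map_mul, map_pow, h1, h2, h3, smul_pow, smul_mul_smul_comm]

theorem span_mon :
    Submodule.span ℂ (Set.range fun m : ℕ × ℕ × ℕ => mon q m.1 m.2.1 m.2.2) = ⊤ := by
  rw [eq_top_iff]
  rintro a -
  have hm : ∀ a b c, mon q a b c ∈
      Submodule.span ℂ (Set.range fun m : ℕ × ℕ × ℕ => mon q m.1 m.2.1 m.2.2) :=
    fun a b c => Submodule.subset_span ⟨(a, b, c), rfl⟩
  induction a using induction_gen with
  | hc c =>
    rw [Algebra.algebraMap_eq_smul_one, ← mon_zero]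
    exact Submodule.smul_mem _ _ (hm _ _ _)
  | hX i =>
    fin_cases i
    · exact Set.mem_of_eq_of_mem Z1_eq_mon (hm 1 0 0)
    · exact Set.mem_of_eq_of_mem Z2_eq_mon (hm 0 1 0)
    · exact Set.mem_of_eq_of_mem Z3_eq_mon (hm 0 0 1)
  | hadd a b ha hb => exact Submodule.add_mem _ ha hb
  | hmul a b ha hb =>
    induction ha using Submodule.span_induction with
    | mem a ha =>
      obtain ⟨m, rfl⟩ := ha
      induction hb using Submodule.span_induction with
      | mem b hb =>
        obtain ⟨n, rfl⟩ := hb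
        simp only [mon_mul_mon]
        exact Submodule.smul_mem _ _ (hm _ _ _)
      | zero => simp
      | add b c _ _ hb hc => rw [mul_add]; exact Submodule.add_mem _ hb hc
      | smul r b _ hb => rw [mul_smul_comm]; exact Submodule.smul_mem _ _ hb
    | zero => simp
    | add b c _ _ hb hc => rw [add_mul]; exact Submodule.add_mem _ hb hc
    | smul r b _ hb => rw [smul_mul_assoc]; exact Submodule.smul_mem _ _ hb

/-! ### The representation on Laurent monomials -/

/-- The space of Laurent polynomials in three variables. -/
abbrev Laurent : Type := (ℤ × ℤ × ℤ) →₀ ℂ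

/-- The exponent in the product `x^p x^m = q^(tw p m) x^(p+m)` of ordered Laurent monomials. -/
def tw (p m : ℤ × ℤ × ℤ) : ℤ := p.2.1 * m.1 + p.2.2 * m.1 + p.2.2 * m.2.1

/-- Left multiplication by the ordered Laurent monomial `x^p` of the quantum torus. -/
def lmon (q : ℂ) (p : ℤ × ℤ × ℤ) : End ℂ Laurent :=
  Finsupp.linearCombination ℂ fun m => q ^ tw p m • Finsupp.single (p + m) (1 : ℂ)

theorem lmon_single (p m : ℤ × ℤ × ℤ) :
    lmon q p (Finsupp.single m 1) = q ^ tw p m • Finsupp.single (p + m) 1 := by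
  simp [lmon]

theorem lmon_mul_lmon (hq : q ≠ 0) (p r : ℤ × ℤ × ℤ) :
    lmon q p * lmon q r = q ^ tw p r • lmon q (p + r) := by
  apply Finsupp.lhom_ext'
  intro m
  apply LinearMap.ext_ring
  simp only [LinearMap.comp_apply, Module.End.mul_apply, LinearMap.smul_apply,
    Finsupp.lsingle_apply, lmon_single, map_smul, smul_smul, ← zpow_add₀ hq, add_assoc]
  congr 2
  simp only [tw, Prod.fst_add, Prod.snd_add]
  ring

theorem lmon_zero : lmon q 0 = 1 := by
  apply Finsupp.lhom_ext'
  intro m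
  apply LinearMap.ext_ring
  simp [lmon_single, tw]

/-- The coefficient of the Laurent monomial `x^p` in an element of the quantum torus. -/
def coef (p : ℤ × ℤ × ℤ) : End ℂ Laurent →ₗ[ℂ] ℂ :=
  Finsupp.lapply p ∘ₗ LinearMap.applyₗ (Finsupp.single (0 : ℤ × ℤ × ℤ) (1 : ℂ))

theorem coef_lmon (p r : ℤ × ℤ × ℤ) : coef p (lmon q r) = if r = p then 1 else 0 := by
  simp [coef, lmon_single, tw, Finsupp.single_apply]

/-- The exponents of the generators. -/
def ee : Fin 3 → ℤ × ℤ × ℤ := ![(1, 0, 0), (0, 1, 0), (0, 0, 1)]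

/-- The embedding of the quantum 3-space into the quantum torus. -/
def emb (q : ℂ) (hq : q ≠ 0) : QSpace q 3 →ₐ[ℂ] End ℂ Laurent :=
  liftHom (fun i => lmon q (ee i)) fun i j h => by
    rw [lmon_mul_lmon hq, lmon_mul_lmon hq, smul_smul, add_comm]
    congr 1
    fin_cases i <;> fin_cases j <;> simp_all [ee, tw]

theorem emb_Xg (hq : q ≠ 0) (i : Fin 3) : emb q hq (Xg q 3 i) = lmon q (ee i) := by
  simp [emb]

theorem emb_mon (hq : q ≠ 0) (a b c : ℕ) :
    emb q hq (mon q a b c) = lmon q ((a : ℤ), (b : ℤ), (c : ℤ)) := by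
  have h1 : ∀ n : ℕ, lmon q (1, 0, 0) ^ n = lmon q ((n : ℤ), 0, 0) := by
    intro n
    induction n with
    | zero => exact lmon_zero.symm
    | succ n ih => rw [pow_succ, ih, lmon_mul_lmon hq]; simp [tw]
  have h2 : ∀ n : ℕ, lmon q (0, 1, 0) ^ n = lmon q (0, (n : ℤ), 0) := by
    intro n
    induction n with
    | zero => exact lmon_zero.symm
    | succ n ih => rw [pow_succ, ih, lmon_mul_lmon hq]; simp [tw]
  have h3 : ∀ n : ℕ, lmon q (0, 0, 1) ^ n = lmon q (0, 0, (n : ℤ)) := by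
    intro n
    induction n with
    | zero => exact lmon_zero.symm
    | succ n ih => rw [pow_succ, ih, lmon_mul_lmon hq]; simp [tw]
  have e1 : emb q hq (Z1 q) = lmon q (1, 0, 0) := emb_Xg hq 0
  have e2 : emb q hq (Z2 q) = lmon q (0, 1, 0) := emb_Xg hq 1
  have e3 : emb q hq (Z3 q) = lmon q (0, 0, 1) := emb_Xg hq 2
  rw [mon, map_mul, map_mul, map_pow, map_pow, map_pow, e1, e2, e3, h1, h2, h3,
    lmon_mul_lmon hq, smul_mul_assoc, lmon_mul_lmon hq]
  simp [tw]

/-- Exponents of polynomial monomials as exponents of Laurent monomials. -/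
def castExp (m : ℕ × ℕ × ℕ) : ℤ × ℤ × ℤ := ((m.1 : ℤ), (m.2.1 : ℤ), (m.2.2 : ℤ))

theorem castExp_injective : Function.Injective castExp := by
  rintro ⟨a, b, c⟩ ⟨a', b', c'⟩ h
  simpa [castExp] using h

theorem linearIndependent_mon (hq : q ≠ 0) :
    LinearIndependent ℂ fun m : ℕ × ℕ × ℕ => mon q m.1 m.2.1 m.2.2 := by
  apply LinearIndependent.of_comp (LinearMap.applyₗ (Finsupp.single (0 : ℤ × ℤ × ℤ) (1 : ℂ)) ∘ₗ
    (emb q hq).toLinearMap)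
  have h := (Finsupp.basisSingleOne (R := ℂ) (ι := ℤ × ℤ × ℤ)).linearIndependent.comp castExp
    castExp_injective
  have e : (LinearMap.applyₗ (Finsupp.single (0 : ℤ × ℤ × ℤ) (1 : ℂ)) ∘ₗ
      (emb q hq).toLinearMap) ∘ (fun m : ℕ × ℕ × ℕ => mon q m.1 m.2.1 m.2.2) =
      Finsupp.basisSingleOne ∘ castExp := by
    funext m
    simp [emb_mon hq, lmon_single, tw, castExp]
  rw [e]
  exact h

/-- The basis of ordered monomials. -/
def monBasis (q : ℂ) (hq : q ≠ 0) : Basis (ℕ × ℕ × ℕ) ℂ (QSpace q 3) :=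
  Basis.mk (linearIndependent_mon hq) span_mon.ge

theorem monBasis_apply (hq : q ≠ 0) (m : ℕ × ℕ × ℕ) :
    monBasis q hq m = mon q m.1 m.2.1 m.2.2 := by
  simp [monBasis]

theorem coef_emb (hq : q ≠ 0) (a : QSpace q 3) (m : ℕ × ℕ × ℕ) :
    coef (castExp m) (emb q hq a) = (monBasis q hq).repr a m := by
  change (coef (castExp m) ∘ₗ (emb q hq).toLinearMap) a = (monBasis q hq).coord m a
  congr 1
  apply (monBasis q hq).ext
  intro n
  have : castExp n = ((n.1 : ℤ), (n.2.1 : ℤ), (n.2.2 : ℤ)) := rfl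
  rw [Basis.coord_apply, Basis.repr_self, Finsupp.single_apply, LinearMap.comp_apply,
    AlgHom.toLinearMap_apply, monBasis_apply, emb_mon hq, ← this, coef_lmon]
  simp [castExp_injective.eq_iff]

theorem emb_injective (hq : q ≠ 0) : Function.Injective (emb q hq) := by
  intro a b h
  apply (monBasis q hq).repr.injective
  ext m
  rw [← coef_emb, ← coef_emb, h]

theorem mon_induction {P : QSpace q 3 → Prop} (hm : ∀ a b c, P (mon q a b c))
    (hadd : ∀ a b, P a → P b → P (a + b)) (hsmul : ∀ (r : ℂ) a, P a → P (r • a))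
    (a : QSpace q 3) : P a := by
  have ha : a ∈ Submodule.span ℂ (Set.range fun m : ℕ × ℕ × ℕ => mon q m.1 m.2.1 m.2.2) := by
    rw [span_mon]; trivial
  induction ha using Submodule.span_induction with
  | mem a ha => obtain ⟨m, rfl⟩ := ha; exact hm _ _ _
  | zero => simpa using hsmul 0 _ (hm 0 0 0)
  | add a b _ _ ha hb => exact hadd _ _ ha hb
  | smul r a _ ha => exact hsmul _ _ ha

/-! ### Construction of the module-algebra structures -/

/-- The linear map with prescribed values on ordered monomials. -/
def monMap (q : ℂ) (hq : q ≠ 0) (σ : ℕ → ℕ → ℕ → QSpace q 3) : QSpace q 3 →ₗ[ℂ] QSpace q 3 :=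
  (monBasis q hq).constr ℂ fun m => σ m.1 m.2.1 m.2.2

theorem monMap_mon (hq : q ≠ 0) (σ : ℕ → ℕ → ℕ → QSpace q 3) (a b c : ℕ) :
    monMap q hq σ (mon q a b c) = σ a b c := by
  rw [monMap, ← monBasis_apply hq (a, b, c), Basis.constr_basis]

/-- The symmetric quantum integer. -/
def qint (q : ℂ) (n : ℕ) : ℂ := (q ^ n - (q ^ n)⁻¹) / (q - q⁻¹)

/-- The eigenvalues of `k₁` and `k₂` on the generators. -/
def kWeight (q : ℂ) : Fin 2 → Fin 3 → ℂ := ![![q, q⁻¹, 1], ![q, q ^ 2, q⁻¹]]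

theorem kWeight_ne_zero (hq : q ≠ 0) (i : Fin 2) (j : Fin 3) : kWeight q i j ≠ 0 := by
  fin_cases i <;> fin_cases j <;> simp [kWeight, hq]

/-- The action of `k₁` and `k₂`. -/
def kAct (q : ℂ) (hq : q ≠ 0) (i : Fin 2) : QSpace q 3 ≃ₐ[ℂ] QSpace q 3 :=
  scale q (kWeight q i) (kWeight_ne_zero hq i)

theorem kAct_mon (hq : q ≠ 0) (i : Fin 2) (a b c : ℕ) :
    kAct q hq i (mon q a b c) =
      (kWeight q i 0 ^ a * kWeight q i 1 ^ b * kWeight q i 2 ^ c) • mon q a b c :=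
  map_mon (kAct q hq i).toAlgHom (scale_Xg _ _ 0) (scale_Xg _ _ 1) (scale_Xg _ _ 2) a b c

theorem kAct_symm_mon (hq : q ≠ 0) (i : Fin 2) (a b c : ℕ) :
    (kAct q hq i).symm (mon q a b c) =
      (kWeight q i 0 ^ a * kWeight q i 1 ^ b * kWeight q i 2 ^ c)⁻¹ • mon q a b c := by
  rw [AlgEquiv.symm_apply_eq, map_smul, kAct_mon, smul_smul, inv_mul_cancel₀, one_smul]
  exact mul_ne_zero (mul_ne_zero (pow_ne_zero _ (kWeight_ne_zero hq _ _))
    (pow_ne_zero _ (kWeight_ne_zero hq _ _))) (pow_ne_zero _ (kWeight_ne_zero hq _ _))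

/-- The action of `e₁` and `e₂`. -/
def eAct (q : ℂ) (hq : q ≠ 0) (α ε : ℂ) : Fin 2 → QSpace q 3 →ₗ[ℂ] QSpace q 3 :=
  ![monMap q hq fun a b c => (α * qint q b) • mon q (a + 1) (b - 1) c,
    monMap q hq fun a b c =>
      (-q * ε⁻¹ / (q ^ 2 - 1) * (q ^ a * q ^ a * q ^ b * q ^ b * (q ^ c)⁻¹ - q ^ c)) •
        mon q a (b + 1) c]

/-- The action of `f₁` and `f₂`. -/
def fAct (q : ℂ) (hq : q ≠ 0) (α ε : ℂ) : Fin 2 → QSpace q 3 →ₗ[ℂ] QSpace q 3 :=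
  ![monMap q hq fun a b c => (α⁻¹ * qint q a) • mon q (a - 1) (b + 1) c,
    monMap q hq fun a b c =>
      (ε * (q ^ a)⁻¹ * ((1 - (q ^ b * q ^ b)⁻¹) / (1 - (q ^ 2)⁻¹))) • mon q a (b - 1) c]

section Formulas

variable (hq : q ≠ 0) (α ε : ℂ) (a b c : ℕ)

theorem kAct_zero_mon : kAct q hq 0 (mon q a b c) = (q ^ a * (q ^ b)⁻¹) • mon q a b c := by
  simp [kAct_mon, kWeight]

theorem kAct_one_mon :
    kAct q hq 1 (mon q a b c) = (q ^ a * (q ^ b * q ^ b) * (q ^ c)⁻¹) • mon q a b c := by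
  simp [kAct_mon, kWeight, ← pow_mul, ← pow_add, mul_comm 2, mul_two]

theorem kAct_symm_zero_mon :
    (kAct q hq 0).symm (mon q a b c) = ((q ^ a)⁻¹ * q ^ b) • mon q a b c := by
  simp [kAct_symm_mon, kWeight, mul_comm]

theorem kAct_symm_one_mon :
    (kAct q hq 1).symm (mon q a b c) =
      ((q ^ a)⁻¹ * (q ^ b)⁻¹ * (q ^ b)⁻¹ * q ^ c) • mon q a b c := by
  rw [kAct_symm_mon]
  congr 1
  simp only [kWeight, Matrix.cons_val_zero, Matrix.cons_val_one, Matrix.cons_val, inv_pow,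
    mul_inv, inv_inv, ← pow_mul]
  rw [mul_comm 2 b, mul_two, pow_add, mul_inv]
  ring

theorem eAct_zero_mon :
    eAct q hq α ε 0 (mon q a b c) = (α * qint q b) • mon q (a + 1) (b - 1) c := by
  simp [eAct, monMap_mon]

theorem eAct_one_mon : eAct q hq α ε 1 (mon q a b c) =
    (-q * ε⁻¹ / (q ^ 2 - 1) * (q ^ a * q ^ a * q ^ b * q ^ b * (q ^ c)⁻¹ - q ^ c)) •
      mon q a (b + 1) c := by
  simp [eAct, monMap_mon]

theorem fAct_zero_mon :
    fAct q hq α ε 0 (mon q a b c) = (α⁻¹ * qint q a) • mon q (a - 1) (b + 1) c := by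
  simp [fAct, monMap_mon]

theorem fAct_one_mon : fAct q hq α ε 1 (mon q a b c) =
    (ε * (q ^ a)⁻¹ * ((1 - (q ^ b * q ^ b)⁻¹) / (1 - (q ^ 2)⁻¹))) • mon q a (b - 1) c := by
  simp [fAct, monMap_mon]

end Formulas

theorem qint_zero : qint q 0 = 0 := by simp [qint]

theorem mul_mon_induction {P : QSpace q 3 → QSpace q 3 → Prop}
    (hm : ∀ a b c a' b' c', P (mon q a b c) (mon q a' b' c'))
    (haddl : ∀ a b x, P a x → P b x → P (a + b) x)
    (haddr : ∀ a x y, P a x → P a y → P a (x + y))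
    (hsmull : ∀ (r : ℂ) a x, P a x → P (r • a) x)
    (hsmulr : ∀ (r : ℂ) a x, P a x → P a (r • x))
    (a x : QSpace q 3) : P a x := by
  induction a using mon_induction with
  | hm a b c =>
    induction x using mon_induction with
    | hm a' b' c' => exact hm a b c a' b' c'
    | hadd x y hx hy => exact haddr _ _ _ hx hy
    | hsmul r x hx => exact hsmulr _ _ _ hx
  | hadd a b ha hb => exact haddl _ _ _ ha hb
  | hsmul r a ha => exact hsmull _ _ _ ha

theorem eAct_mul_of_mon (k : QSpace q 3 ≃ₐ[ℂ] QSpace q 3) (e : QSpace q 3 →ₗ[ℂ] QSpace q 3)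
    (h : ∀ a b c a' b' c', e (mon q a b c * mon q a' b' c') =
      mon q a b c * e (mon q a' b' c') + e (mon q a b c) * k (mon q a' b' c'))
    (x y : QSpace q 3) : e (x * y) = x * e y + e x * k y := by
  induction x, y using mul_mon_induction with
  | hm a b c a' b' c' => exact h a b c a' b' c'
  | haddl a b x ha hb => simp only [add_mul, map_add, ha, hb]; abel
  | haddr a x y hx hy => simp only [mul_add, map_add, hx, hy]; abel
  | hsmull r a x h => simp only [smul_mul_assoc, map_smul, h, smul_add]
  | hsmulr r a x h => simp only [mul_smul_comm, map_smul, h, smul_add]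

theorem fAct_mul_of_mon (k : QSpace q 3 ≃ₐ[ℂ] QSpace q 3) (f : QSpace q 3 →ₗ[ℂ] QSpace q 3)
    (h : ∀ a b c a' b' c', f (mon q a b c * mon q a' b' c') =
      k (mon q a b c) * f (mon q a' b' c') + f (mon q a b c) * mon q a' b' c')
    (x y : QSpace q 3) : f (x * y) = k x * f y + f x * y := by
  induction x, y using mul_mon_induction with
  | hm a b c a' b' c' => exact h a b c a' b' c'
  | haddl a b x ha hb => simp only [add_mul, map_add, ha, hb]; abel
  | haddr a x y hx hy => simp only [mul_add, map_add, hx, hy]; abel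
  | hsmull r a x h => simp only [smul_mul_assoc, map_smul, h, smul_add]
  | hsmulr r a x h => simp only [mul_smul_comm, map_smul, h, smul_add]

theorem eAct_mul (hq : q ≠ 0) (α ε : ℂ) (i : Fin 2) (x y : QSpace q 3) :
    eAct q hq α ε i (x * y) = x * eAct q hq α ε i y + eAct q hq α ε i x * kAct q hq i y := by
  refine eAct_mul_of_mon _ _ (fun a b c a' b' c' => ?_) x y
  fin_cases i
  · simp only [Fin.zero_eta, mon_mul_mon, map_smul, eAct_zero_mon, kAct_zero_mon, mul_smul_comm,
      smul_mul_assoc, smul_smul]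
    rcases b with _ | b <;> rcases b' with _ | b'
    · simp [qint_zero]
    all_goals
      simp only [qint_zero, mul_zero, zero_smul, zero_mul, zero_add, add_zero,
        Nat.add_sub_cancel, ← add_assoc, ← add_smul, add_right_comm _ 1]
      congr 1
      simp only [qint]
      field_simp
      ring
  · simp only [Fin.mk_one, mon_mul_mon, map_smul, eAct_one_mon, kAct_one_mon, mul_smul_comm,
      smul_mul_assoc, smul_smul, ← add_assoc, ← add_smul, add_right_comm _ 1]
    congr 1
    field_simp
    ring

theorem fAct_mul (hq : q ≠ 0) (α ε : ℂ) (i : Fin 2) (x y : QSpace q 3) :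
    fAct q hq α ε i (x * y) =
      (kAct q hq i).symm x * fAct q hq α ε i y + fAct q hq α ε i x * y := by
  refine fAct_mul_of_mon (kAct q hq i).symm _ (fun a b c a' b' c' => ?_) x y
  fin_cases i
  · simp only [Fin.zero_eta, mon_mul_mon, map_smul, fAct_zero_mon, kAct_symm_zero_mon,
      mul_smul_comm, smul_mul_assoc, smul_smul]
    rcases a with _ | a <;> rcases a' with _ | a'
    · simp [qint_zero]
    all_goals
      simp only [qint_zero, mul_zero, zero_smul, zero_mul, zero_add, add_zero,
        Nat.add_sub_cancel, ← add_assoc, ← add_smul, add_right_comm _ 1]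
      congr 1
      simp only [qint]
      field_simp
      try ring
  · simp only [Fin.mk_one, mon_mul_mon, map_smul, fAct_one_mon, kAct_symm_one_mon, mul_smul_comm,
      smul_mul_assoc, smul_smul]
    rcases b with _ | b <;> rcases b' with _ | b'
    · simp
    all_goals
      simp only [pow_zero, mul_one, inv_one, sub_self, zero_div,
        mul_zero, zero_smul, zero_mul, zero_add, add_zero,
        Nat.add_sub_cancel, ← add_assoc, ← add_smul, add_right_comm _ 1]
      congr 1
      field_simp
      ring

theorem sub_inv_ne_zero (hq : q ≠ 0) (hq' : ∀ N : ℕ, 0 < N → q ^ N ≠ 1) : q - q⁻¹ ≠ 0 := by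
  intro h
  apply hq' 2 (by norm_num)
  field_simp at h
  linear_combination h

theorem kAct_eAct (hq : q ≠ 0) (α ε : ℂ) (i j : Fin 2) (x : QSpace q 3) :
    kAct q hq i (eAct q hq α ε j ((kAct q hq i).symm x)) =
      q ^ cartan 2 i j • eAct q hq α ε j x := by
  induction x using mon_induction with
  | hm a b c =>
    fin_cases i <;> fin_cases j <;>
    simp only [Fin.zero_eta, Fin.mk_one, kAct_symm_zero_mon, kAct_symm_one_mon, map_smul,
      eAct_zero_mon, eAct_one_mon, kAct_zero_mon, kAct_one_mon, smul_smul]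
    · rcases b with _ | b
      · simp [qint_zero]
      · congr 1
        simp [cartan]
        field_simp
        ring
    · congr 1
      simp [cartan]
      field_simp
      ring
    · rcases b with _ | b
      · simp [qint_zero]
      · congr 1
        simp [cartan]
        field_simp
        ring
    · congr 1
      simp [cartan]
      field_simp
      ring
  | hadd a b ha hb => simp only [map_add, smul_add, ha, hb]
  | hsmul r a ha => simp only [map_smul, ha]; rw [smul_comm]

theorem kAct_fAct (hq : q ≠ 0) (α ε : ℂ) (i j : Fin 2) (x : QSpace q 3) :
    kAct q hq i (fAct q hq α ε j ((kAct q hq i).symm x)) =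
      q ^ (-cartan 2 i j) • fAct q hq α ε j x := by
  induction x using mon_induction with
  | hm a b c =>
    fin_cases i <;> fin_cases j <;>
    simp only [Fin.zero_eta, Fin.mk_one, kAct_symm_zero_mon, kAct_symm_one_mon, map_smul,
      fAct_zero_mon, fAct_one_mon, kAct_zero_mon, kAct_one_mon, smul_smul]
    · rcases a with _ | a
      · simp [qint_zero]
      · congr 1
        simp [cartan]
        field_simp
        ring
    · rcases b with _ | b
      · simp
      · congr 1
        simp [cartan]
        field_simp
        ring
    · rcases a with _ | a
      · simp [qint_zero]
      · congr 1
        simp [cartan]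
        field_simp
        ring
    · rcases b with _ | b
      · simp
      · congr 1
        simp [cartan]
        field_simp
        ring
  | hadd a b ha hb => simp only [map_add, smul_add, ha, hb]
  | hsmul r a ha => simp only [map_smul, ha]; rw [smul_comm]

theorem eAct_fAct (hq : q ≠ 0) (hq' : ∀ N : ℕ, 0 < N → q ^ N ≠ 1) {α ε : ℂ} (hα : α ≠ 0)
    (hε : ε ≠ 0) (i j : Fin 2) (x : QSpace q 3) :
    eAct q hq α ε i (fAct q hq α ε j x) - fAct q hq α ε j (eAct q hq α ε i x) =
      if i = j then (q - q⁻¹)⁻¹ • (kAct q hq i x - (kAct q hq i).symm x) else 0 := by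
  have h2 : q ^ 2 - 1 ≠ 0 := sub_ne_zero.mpr (hq' 2 (by norm_num))
  have h1 : q - q⁻¹ = (q ^ 2 - 1) / q := by field_simp
  have h3 : 1 - (q ^ 2)⁻¹ = (q ^ 2 - 1) / q ^ 2 := by field_simp
  induction x using mon_induction with
  | hm a b c =>
    fin_cases i <;> fin_cases j <;>
    simp only [Fin.zero_eta, Fin.mk_one, kAct_symm_zero_mon, kAct_symm_one_mon, map_smul,
      fAct_zero_mon, fAct_one_mon, kAct_zero_mon, kAct_one_mon, smul_smul, if_true,
      eAct_zero_mon, eAct_one_mon, zero_ne_one, one_ne_zero, if_false, qint, h1, h3]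
    · rcases a with _ | a <;> rcases b with _ | b <;>
        simp only [Nat.add_sub_cancel, zero_add, pow_succ, pow_zero] <;> match_scalars <;> simp
      all_goals field_simp
      all_goals try ring
    · rcases b with _ | _ | b <;>
        simp only [Nat.add_sub_cancel, zero_add, pow_succ, pow_zero] <;> match_scalars <;> simp
      all_goals field_simp
      all_goals try ring
    · rcases a with _ | a <;>
        simp only [Nat.add_sub_cancel, pow_succ, pow_zero] <;> match_scalars <;> simp
      all_goals field_simp
      all_goals try ring
    · rcases b with _ | b <;>
        simp only [Nat.add_sub_cancel, zero_add, pow_succ, pow_zero] <;> match_scalars <;> simp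
      all_goals field_simp
      all_goals try ring
  | hadd a b ha hb =>
    have := congrArg₂ (· + ·) ha hb
    split_ifs at this ⊢ <;> simp only [map_add, add_zero] at this ⊢
    · convert this using 1
      · abel
      · module
    · rw [← this]; abel
  | hsmul r a ha =>
    have := congrArg (r • ·) ha
    split_ifs at this ⊢ <;> simp only [map_smul, smul_zero] at this ⊢
    · convert this using 1 <;> module
    · rw [← this]; module

theorem eAct_serre (hq : q ≠ 0) (hq' : ∀ N : ℕ, 0 < N → q ^ N ≠ 1) (α ε : ℂ) (i j : Fin 2)
    (h : cartan 2 i j = -1) (x : QSpace q 3) :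
    eAct q hq α ε i (eAct q hq α ε i (eAct q hq α ε j x)) -
      (q + q⁻¹) • eAct q hq α ε i (eAct q hq α ε j (eAct q hq α ε i x)) +
      eAct q hq α ε j (eAct q hq α ε i (eAct q hq α ε i x)) = 0 := by
  have h2 : q ^ 2 - 1 ≠ 0 := sub_ne_zero.mpr (hq' 2 (by norm_num))
  have h1 : q - q⁻¹ = (q ^ 2 - 1) / q := by field_simp
  induction x using mon_induction with
  | hm a b c =>
    fin_cases i <;> fin_cases j
    · simp [cartan] at h
    · rcases b with _ | _ | b <;>
        simp only [Fin.zero_eta, Fin.mk_one, map_smul, smul_smul, eAct_zero_mon, eAct_one_mon,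
          Nat.add_sub_cancel, zero_add, qint, h1] <;> match_scalars <;> simp
      all_goals field_simp
      all_goals try ring
    · rcases b with _ | b <;>
        simp only [Fin.zero_eta, Fin.mk_one, map_smul, smul_smul, eAct_zero_mon, eAct_one_mon,
          Nat.add_sub_cancel, zero_add, qint, h1] <;> match_scalars <;> simp
      all_goals field_simp
      all_goals try ring
    · simp [cartan] at h
  | hadd a b ha hb =>
    have := congrArg₂ (· + ·) ha hb
    simp only [map_add, add_zero] at this ⊢
    rw [← this]
    module
  | hsmul r a ha =>
    have := congrArg (r • ·) ha
    simp only [map_smul, smul_zero] at this ⊢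
    rw [← this]
    module

theorem fAct_serre (hq : q ≠ 0) (hq' : ∀ N : ℕ, 0 < N → q ^ N ≠ 1) (α ε : ℂ) (i j : Fin 2)
    (h : cartan 2 i j = -1) (x : QSpace q 3) :
    fAct q hq α ε i (fAct q hq α ε i (fAct q hq α ε j x)) -
      (q + q⁻¹) • fAct q hq α ε i (fAct q hq α ε j (fAct q hq α ε i x)) +
      fAct q hq α ε j (fAct q hq α ε i (fAct q hq α ε i x)) = 0 := by
  have h2 : q ^ 2 - 1 ≠ 0 := sub_ne_zero.mpr (hq' 2 (by norm_num))
  have h1 : q - q⁻¹ = (q ^ 2 - 1) / q := by field_simp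
  have h3 : 1 - (q ^ 2)⁻¹ = (q ^ 2 - 1) / q ^ 2 := by field_simp
  induction x using mon_induction with
  | hm a b c =>
    fin_cases i <;> fin_cases j
    · simp [cartan] at h
    · rcases a with _ | _ | a <;> rcases b with _ | b <;>
        simp only [Fin.zero_eta, Fin.mk_one, map_smul, smul_smul, fAct_zero_mon, fAct_one_mon,
          Nat.add_sub_cancel, zero_add, qint, h1, h3] <;> match_scalars <;> simp
      all_goals field_simp
      all_goals try ring
    · rcases a with _ | a <;> rcases b with _ | _ | b <;>
        simp only [Fin.zero_eta, Fin.mk_one, map_smul, smul_smul, fAct_zero_mon, fAct_one_mon,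
          Nat.add_sub_cancel, zero_add, qint, h1, h3] <;> match_scalars <;> simp
      all_goals field_simp
      all_goals try ring
    · simp [cartan] at h
  | hadd a b ha hb =>
    have := congrArg₂ (· + ·) ha hb
    simp only [map_add, add_zero] at this ⊢
    rw [← this]
    module
  | hsmul r a ha =>
    have := congrArg (r • ·) ha
    simp only [map_smul, smul_zero] at this ⊢
    rw [← this]
    module

/-- The module-algebra structure with parameters `α` and `ε`. -/
def structureOf (q : ℂ) (hq : q ≠ 0) (hq' : ∀ N : ℕ, 0 < N → q ^ N ≠ 1) (α ε : ℂ) (hα : α ≠ 0)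
    (hε : ε ≠ 0) : UqslMA q 2 (QSpace q 3) where
  k := kAct q hq
  e := eAct q hq α ε
  f := fAct q hq α ε
  e_mul := eAct_mul hq α ε
  f_mul := fAct_mul hq α ε
  e_one i := by
    fin_cases i
    · simp [← mon_zero, eAct_zero_mon, qint_zero]
    · simp [← mon_zero, eAct_one_mon]
  f_one i := by
    fin_cases i
    · simp [← mon_zero, fAct_zero_mon, qint_zero]
    · simp [← mon_zero, fAct_one_mon]
  k_comm i j x := by
    induction x using mon_induction with
    | hm a b c => simp only [kAct_mon, map_smul]; rw [smul_comm]
    | hadd a b ha hb => simp only [map_add, ha, hb]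
    | hsmul r a ha => simp only [map_smul, ha]
  ke := kAct_eAct hq α ε
  kf := kAct_fAct hq α ε
  ef := eAct_fAct hq hq' hα hε
  ee_comm i j h := by fin_cases i <;> fin_cases j <;> simp [cartan] at h
  ff_comm i j h := by fin_cases i <;> fin_cases j <;> simp [cartan] at h
  serre_e := eAct_serre hq hq' α ε
  serre_f := fAct_serre hq hq' α ε

theorem structureOf_kCond (hq : q ≠ 0) (hq' : ∀ N : ℕ, 0 < N → q ^ N ≠ 1) {α ε : ℂ}
    (hα : α ≠ 0) (hε : ε ≠ 0) : KCond17 q (structureOf q hq hq' α ε hα hε) := by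
  refine ⟨?_, ?_, ?_, ?_, ?_, ?_⟩ <;>
    simp [structureOf, Z1_eq_mon, Z2_eq_mon, Z3_eq_mon, kAct_mon, kWeight]

theorem structureOf_efDesc (hq : q ≠ 0) (hq' : ∀ N : ℕ, 0 < N → q ^ N ≠ 1) {α ε : ℂ}
    (hα : α ≠ 0) (hε : ε ≠ 0) : EFDesc17 q (structureOf q hq hq' α ε hα hε) α ε := by
  have h2 : q ^ 2 - 1 ≠ 0 := sub_ne_zero.mpr (hq' 2 (by norm_num))
  have h1 := sub_inv_ne_zero hq hq'
  have h3 : 1 - (q * q)⁻¹ ≠ 0 := by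
    intro h
    apply h2
    linear_combination q ^ 2 * h + mul_inv_cancel₀ (mul_ne_zero hq hq)
  refine ⟨?_, ?_, ?_, ?_, ?_, ?_, ?_, ?_, ?_, ?_, ?_, ?_⟩ <;>
    simp only [structureOf, Z1_eq_mon, Z2_eq_mon, Z3_eq_mon, eAct_zero_mon, eAct_one_mon,
      fAct_zero_mon, fAct_one_mon, ← mon_zero]
  · simp [qint]
  · simp [qint, h1]
  · simp [qint]
  · simp only [mon_mul_mon]
    match_scalars
    simp
    field_simp
  · simp only [sq (mon q 0 1 0), mon_mul_mon]
    match_scalars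
    simp
    field_simp
  · simp only [mon_mul_mon]
    match_scalars
    simp
    field_simp
    ring
  · simp [qint, h1]
  · simp [qint]
  · simp [qint]
  · simp
  · rw [pow_zero, pow_one, sq, div_self h3]
    simp
  · simp

/-! ### Coefficients and weights -/

theorem exists_castExp_of_coef_ne_zero (hq : q ≠ 0) {a : QSpace q 3} {p : ℤ × ℤ × ℤ}
    (h : coef p (emb q hq a) ≠ 0) : ∃ m, castExp m = p := by
  by_contra! hp
  apply h
  clear h
  induction a using mon_induction with
  | hm a b c =>
    rw [emb_mon, coef_lmon, if_neg]
    exact hp (a, b, c)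
  | hadd a b ha hb => rw [map_add, map_add, ha, hb, add_zero]
  | hsmul r a ha => rw [map_smul, map_smul, ha, smul_zero]

theorem emb_eq_sum (hq : q ≠ 0) (a : QSpace q 3) {σ : ℕ → ℤ × ℤ × ℤ}
    (hσ : Function.Injective σ) (h : ∀ p, coef p (emb q hq a) ≠ 0 → ∃ j, σ j = p) :
    ∃ N, (∀ j, N ≤ j → coef (σ j) (emb q hq a) = 0) ∧ ∀ M, N ≤ M →
      emb q hq a = ∑ j ∈ Finset.range M, coef (σ j) (emb q hq a) • lmon q (σ j) := by
  classical
  set S : Finset (ℤ × ℤ × ℤ) := ((monBasis q hq).repr a).support.image castExp with hS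
  have hmem : ∀ p, p ∈ S ↔ coef p (emb q hq a) ≠ 0 := by
    intro p
    constructor
    · intro hp
      obtain ⟨m, hm, rfl⟩ := Finset.mem_image.mp hp
      rw [coef_emb]
      exact Finsupp.mem_support_iff.mp hm
    · intro hp
      obtain ⟨m, rfl⟩ := exists_castExp_of_coef_ne_zero hq hp
      rw [coef_emb] at hp
      exact Finset.mem_image_of_mem _ (Finsupp.mem_support_iff.mpr hp)
  have hsum : emb q hq a = ∑ p ∈ S, coef p (emb q hq a) • lmon q p := by
    rw [hS, Finset.sum_image castExp_injective.injOn]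
    conv_lhs => rw [← (monBasis q hq).linearCombination_repr a]
    rw [Finsupp.linearCombination_apply, Finsupp.sum, map_sum]
    refine Finset.sum_congr rfl fun m _ => ?_
    rw [map_smul, monBasis_apply, emb_mon, coef_emb]
    rfl
  obtain ⟨N, hN⟩ : ∃ N, ∀ j, σ j ∈ S → j < N := by
    have hfin : (σ ⁻¹' (S : Set (ℤ × ℤ × ℤ))).Finite := S.finite_toSet.preimage hσ.injOn
    obtain ⟨N, hN⟩ := hfin.bddAbove
    exact ⟨N + 1, fun j hj => Nat.lt_succ_of_le (hN hj)⟩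
  refine ⟨N, fun j hj => ?_, fun M hM => ?_⟩
  · by_contra hne
    exact absurd (hN j ((hmem _).mpr hne)) (not_lt.mpr hj)
  · rw [← Finset.sum_image (f := fun p => coef p (emb q hq a) • lmon q p) hσ.injOn]
    nth_rewrite 1 [hsum]
    refine Finset.sum_subset (fun p hp => ?_) fun p _ hp => ?_
    · obtain ⟨j, rfl⟩ := h p ((hmem p).mp hp)
      exact Finset.mem_image_of_mem _ (Finset.mem_range.mpr ((hN j hp).trans_le hM))
    · rw [hmem, not_not] at hp
      rw [hp, zero_smul]

theorem coef_lmon_mul (hq : q ≠ 0) (a : QSpace q 3) (p r : ℤ × ℤ × ℤ) :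
    coef (p + r) (lmon q p * emb q hq a) = q ^ tw p r * coef r (emb q hq a) := by
  induction a using mon_induction with
  | hm a b c =>
    rw [emb_mon, lmon_mul_lmon hq, map_smul, coef_lmon, coef_lmon]
    by_cases h : ((a : ℤ), (b : ℤ), (c : ℤ)) = r
    · simp [h]
    · simp [h]
  | hadd a b ha hb => simp only [map_add, mul_add, ha, hb]
  | hsmul r a ha => simp only [map_smul, mul_smul_comm, ha, smul_eq_mul]; ring

theorem coef_mul_lmon (hq : q ≠ 0) (a : QSpace q 3) (p r : ℤ × ℤ × ℤ) :
    coef (r + p) (emb q hq a * lmon q p) = q ^ tw r p * coef r (emb q hq a) := by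
  induction a using mon_induction with
  | hm a b c =>
    rw [emb_mon, lmon_mul_lmon hq, map_smul, coef_lmon, coef_lmon]
    by_cases h : ((a : ℤ), (b : ℤ), (c : ℤ)) = r
    · simp [h]
    · simp [h]
  | hadd a b ha hb => simp only [map_add, add_mul, mul_add, ha, hb]
  | hsmul r a ha => simp only [map_smul, smul_mul_assoc, ha, smul_eq_mul]; ring

/-- The weights of Laurent monomials with respect to `k₁` and `k₂`. -/
def wt (l : Fin 2) (p : ℤ × ℤ × ℤ) : ℤ :=
  if l = 0 then p.1 - p.2.1 else p.1 + 2 * p.2.1 - p.2.2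

theorem wt_add (l : Fin 2) (p r : ℤ × ℤ × ℤ) : wt l (p + r) = wt l p + wt l r := by
  unfold wt
  split_ifs <;> simp only [Prod.fst_add, Prod.snd_add] <;> ring

theorem wt_neg (l : Fin 2) (p : ℤ × ℤ × ℤ) : wt l (-p) = -wt l p := by
  unfold wt
  split_ifs <;> simp only [Prod.fst_neg, Prod.snd_neg] <;> ring

theorem zpow_inj_of_not_root (hq : q ≠ 0) (hq' : ∀ N : ℕ, 0 < N → q ^ N ≠ 1) {m n : ℤ}
    (h : q ^ m = q ^ n) : m = n := by
  have key : ∀ k : ℤ, 0 < k → q ^ k ≠ 1 := by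
    intro k hk
    obtain ⟨N, rfl⟩ := Int.eq_ofNat_of_zero_le hk.le
    rw [zpow_natCast]
    exact hq' N (by exact_mod_cast hk)
  rcases lt_trichotomy m n with hlt | heq | hgt
  · refine absurd ?_ (key (n - m) (by omega))
    rw [zpow_sub₀ hq, h, div_self (zpow_ne_zero _ hq)]
  · exact heq
  · refine absurd ?_ (key (m - n) (by omega))
    rw [zpow_sub₀ hq, h, div_self (zpow_ne_zero _ hq)]

theorem zpow_sub_zpow_ne_zero (hq : q ≠ 0) (hq' : ∀ N : ℕ, 0 < N → q ^ N ≠ 1) {m n : ℤ}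
    (h : m ≠ n) : q ^ m - q ^ n ≠ 0 :=
  sub_ne_zero.mpr fun h' => h (zpow_inj_of_not_root hq hq' h')

/-- `k` acts on the generators with the weights `wt l`. -/
def ActsByWeight (q : ℂ) (l : Fin 2) (k : QSpace q 3 ≃ₐ[ℂ] QSpace q 3) : Prop :=
  ∀ i, k (Xg q 3 i) = q ^ wt l (ee i) • Xg q 3 i

theorem ActsByWeight.map_mon (hq : q ≠ 0) {l : Fin 2} {k : QSpace q 3 ≃ₐ[ℂ] QSpace q 3}
    (hk : ActsByWeight q l k) (m : ℕ × ℕ × ℕ) :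
    k (mon q m.1 m.2.1 m.2.2) = q ^ wt l (castExp m) • mon q m.1 m.2.1 m.2.2 := by
  rw [← AlgEquiv.coe_toAlgHom k, QuantumThreeSpace.map_mon k.toAlgHom (hk 0) (hk 1) (hk 2)]
  simp only [← zpow_natCast, ← zpow_mul, ← zpow_add₀ hq]
  congr 2
  fin_cases l <;> simp [wt, ee, castExp] <;> ring

theorem ActsByWeight.coef_emb_map (hq : q ≠ 0) {l : Fin 2} {k : QSpace q 3 ≃ₐ[ℂ] QSpace q 3}
    (hk : ActsByWeight q l k) (a : QSpace q 3) (p : ℤ × ℤ × ℤ) :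
    coef p (emb q hq (k a)) = q ^ wt l p * coef p (emb q hq a) := by
  induction a using mon_induction with
  | hm a b c =>
    rw [hk.map_mon hq (a, b, c), map_smul, map_smul, emb_mon, coef_lmon]
    by_cases h : ((a : ℤ), (b : ℤ), (c : ℤ)) = p
    · simp [← h, castExp]
    · simp [h]
  | hadd a b ha hb => simp only [map_add, ha, hb, mul_add]
  | hsmul r a ha => simp only [map_smul, ha, smul_eq_mul]; ring

theorem ActsByWeight.wt_eq (hq : q ≠ 0) (hq' : ∀ N : ℕ, 0 < N → q ^ N ≠ 1) {l : Fin 2}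
    {k : QSpace q 3 ≃ₐ[ℂ] QSpace q 3} (hk : ActsByWeight q l k) {a : QSpace q 3} {n : ℤ}
    (ha : k a = q ^ n • a) {p : ℤ × ℤ × ℤ} (hp : coef p (emb q hq a) ≠ 0) : wt l p = n := by
  have h := hk.coef_emb_map hq a p
  rw [ha, map_smul, map_smul, smul_eq_mul] at h
  exact (zpow_inj_of_not_root hq hq' (mul_right_cancel₀ hp h)).symm

/-! ### Skew derivations of the quantum 3-space are inner in the quantum torus -/

theorem tw_add_left (p r m : ℤ × ℤ × ℤ) : tw (p + r) m = tw p m + tw r m := by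
  simp only [tw, Prod.fst_add, Prod.snd_add]; ring

theorem tw_add_right (p m n : ℤ × ℤ × ℤ) : tw p (m + n) = tw p m + tw p n := by
  simp only [tw, Prod.fst_add, Prod.snd_add]; ring

/-- The shift of an exponent by a multiple of `(1, 1, 3)`, the exponents of weight zero. -/
def sh (s : ℤ × ℤ × ℤ) (j : ℕ) : ℤ × ℤ × ℤ := (s.1 + j, s.2.1 + j, s.2.2 + 3 * j)

theorem sh_zero (s : ℤ × ℤ × ℤ) : sh s 0 = s := by simp [sh]

theorem sh_injective (s : ℤ × ℤ × ℤ) : Function.Injective (sh s) := by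
  intro i j h
  simpa [sh] using congrArg Prod.fst h

theorem sh_add_injective (s r : ℤ × ℤ × ℤ) : Function.Injective fun j => sh s j + r :=
  (add_left_injective r).comp (sh_injective s)

/-- The scalar by which the skew inner derivation of `x^p` acts on the generator `x_i`. -/
def lam (q : ℂ) (l : Fin 2) (p : ℤ × ℤ × ℤ) (i : Fin 3) : ℂ :=
  q ^ (wt l (ee i) + tw p (ee i)) - q ^ tw (ee i) p

section Inner

variable {l : Fin 2} {k : QSpace q 3 ≃ₐ[ℂ] QSpace q 3} {D : QSpace q 3 →ₗ[ℂ] QSpace q 3}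

theorem coef_mul_lam_comm (hq : q ≠ 0) (hk : ActsByWeight q l k)
    (hD : ∀ a b, D (a * b) = a * D b + D a * k b) (p : ℤ × ℤ × ℤ) (i i' : Fin 3) :
    coef (p + ee i) (emb q hq (D (Xg q 3 i))) * lam q l p i' =
      coef (p + ee i') (emb q hq (D (Xg q 3 i'))) * lam q l p i := by
  wlog h : i < i' generalizing i i'
  · rcases (not_lt.mp h).eq_or_lt with rfl | h
    · rfl
    · exact (this i' i h).symm
  have hrel := congrArg (fun x => coef (p + ee i + ee i') (emb q hq (D x))) (Xg_mul_Xg i' i h)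
  have h1 : p + ee i + ee i' = ee i' + (p + ee i) := by abel
  have h2 : p + ee i + ee i' = (p + ee i') + ee i := by abel
  have h3 : p + ee i + ee i' = ee i + (p + ee i') := by abel
  simp only [map_smul, hD, map_add, map_mul, hk i, hk i', emb_Xg, mul_smul_comm, smul_eq_mul]
    at hrel
  rw [coef_mul_lmon hq _ (ee i') (p + ee i), h1, coef_lmon_mul, ← h1, h2, coef_mul_lmon, ← h2, h3,
    coef_lmon_mul] at hrel
  simp only [tw_add_left, tw_add_right] at hrel
  have t1 : tw (ee i') (ee i) = 1 := by
    fin_cases i <;> fin_cases i' <;> simp_all [ee, tw]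
  have t2 : tw (ee i) (ee i') = 0 := by
    fin_cases i <;> fin_cases i' <;> simp_all [ee, tw]
  rw [t1, t2] at hrel
  simp only [add_zero, zpow_add₀ hq, zpow_one] at hrel
  simp only [lam, zpow_add₀ hq]
  apply mul_left_cancel₀ hq
  linear_combination -hrel

theorem exists_inner (hq : q ≠ 0) (hk : ActsByWeight q l k)
    (hD : ∀ a b, D (a * b) = a * D b + D a * k b) {s : ℤ × ℤ × ℤ}
    (hsupp : ∀ i p, coef p (emb q hq (D (Xg q 3 i))) ≠ 0 → ∃ j, sh s j + ee i = p)
    (hlam : ∀ j, ∃ i, lam q l (sh s j) i ≠ 0) :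
    ∃ (N : ℕ) (c : ℕ → ℂ), (∀ j, N ≤ j → c j = 0) ∧
      ∀ a, emb q hq (D a) + emb q hq a * ∑ j ∈ Finset.range N, c j • lmon q (sh s j) =
        (∑ j ∈ Finset.range N, c j • lmon q (sh s j)) * emb q hq (k a) := by
  choose ι hι using hlam
  choose N hN hsum using fun i =>
    emb_eq_sum hq (D (Xg q 3 i)) (sh_add_injective s (ee i)) (hsupp i)
  have hle : ∀ i, N i ≤ ∑ i, N i := fun i =>
    Finset.single_le_sum (f := N) (fun _ _ => Nat.zero_le _) (Finset.mem_univ i)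
  have hD1 : D 1 = 0 := by simpa using hD 1 1
  refine ⟨∑ i, N i, fun j => coef (sh s j + ee (ι j)) (emb q hq (D (Xg q 3 (ι j)))) /
    lam q l (sh s j) (ι j), fun j hj => ?_, fun a => ?_⟩
  · simp only [hN (ι j) j ((hle _).trans hj), zero_div]
  induction a using induction_gen with
  | hc c =>
    simp only [Algebra.algebraMap_eq_smul_one, map_smul, hD1, map_one, map_zero, smul_zero,
      mul_smul_comm, smul_mul_assoc, mul_one, one_mul, zero_add]
  | hX i =>
    rw [hsum i _ (hle i), hk i, map_smul, emb_Xg, Finset.sum_mul, Finset.mul_sum,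
      ← Finset.sum_add_distrib]
    refine Finset.sum_congr rfl fun j _ => ?_
    rw [smul_mul_smul_comm, mul_smul_comm, lmon_mul_lmon hq, lmon_mul_lmon hq, smul_smul,
      smul_smul, add_comm (ee i), ← add_smul]
    congr 1
    have h := coef_mul_lam_comm hq hk hD (sh s j) i (ι j)
    have hj := hι j
    simp only [lam, zpow_add₀ hq] at h hj ⊢
    field_simp
    linear_combination h
  | hadd a b ha hb =>
    simp only [map_add, mul_add, ← ha, ← hb, add_mul]
    abel
  | hmul a b ha hb =>
    simp only [hD, map_add, map_mul]
    rw [← mul_assoc, ← ha, add_mul, mul_assoc _ _ (emb q hq (k b)), ← hb]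
    simp only [mul_add, mul_assoc]
    abel

end Inner


theorem eq_zero_of_sum_antidiagonal {c d : ℕ → ℂ} {N M : ℕ} (hc : ∀ j, N ≤ j → c j = 0)
    (hd : ∀ j, M ≤ j → d j = 0) {G : ℕ → ℕ → ℂ} (hG : ∀ i j, G i j ≠ 0) {K : ℂ} (hK : K ≠ 0)
    (h : ∀ n, (∑ i ∈ Finset.range N, ∑ j ∈ Finset.range M,
      if i + j = n then c i * d j * G i j else 0) = if n = 0 then K else 0) :
    (∀ j, 0 < j → c j = 0) ∧ (∀ j, 0 < j → d j = 0) ∧ c 0 * d 0 * G 0 0 = K := by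
  classical
  have exists_top : ∀ (c : ℕ → ℂ) (N : ℕ), (∀ j, N ≤ j → c j = 0) → c ≠ 0 →
      ∃ J, c J ≠ 0 ∧ J ∈ Finset.range N ∧ ∀ j, J < j → c j = 0 := by
    intro c N hc hne
    have hmem : ∀ j, c j ≠ 0 → j ∈ (Finset.range N).filter fun j => c j ≠ 0 := by
      intro j hj
      rw [Finset.mem_filter, Finset.mem_range]
      exact ⟨not_le.mp fun hle => hj (hc j hle), hj⟩
    obtain ⟨j, hj⟩ := Function.ne_iff.mp hne
    obtain ⟨J, hJ, hmax⟩ := Finset.exists_max_image _ id ⟨j, hmem j hj⟩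
    rw [Finset.mem_filter] at hJ
    refine ⟨J, hJ.2, hJ.1, fun i hi => ?_⟩
    by_contra hci
    exact absurd (hmax i (hmem i hci)) (not_le.mpr hi)
  have hc0 : c ≠ 0 := by
    rintro rfl
    apply hK
    simpa using (h 0).symm
  have hd0 : d ≠ 0 := by
    rintro rfl
    apply hK
    simpa using (h 0).symm
  obtain ⟨I, hI, hIN, hI'⟩ := exists_top c N hc hc0
  obtain ⟨J, hJ, hJM, hJ'⟩ := exists_top d M hd hd0
  have hIJ := h (I + J)
  rw [Finset.sum_eq_single I, Finset.sum_eq_single J, if_pos rfl] at hIJ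
  · have h0 : I + J = 0 := by
      by_contra hne
      rw [if_neg hne] at hIJ
      exact mul_ne_zero (mul_ne_zero hI hJ) (hG I J) hIJ
    obtain ⟨rfl, rfl⟩ := Nat.add_eq_zero_iff.mp h0
    exact ⟨hI', hJ', hIJ⟩
  · intro j _ hj
    rw [if_neg (by omega)]
  · exact fun hn => absurd hJM hn
  · intro i _ hi
    refine Finset.sum_eq_zero fun j _ => ?_
    split_ifs with hij
    · rcases lt_or_gt_of_ne hi with hlt | hgt
      · rw [hJ' j (by omega), mul_zero, zero_mul]
      · rw [hI' i hgt, zero_mul, zero_mul]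
    · rfl
  · exact fun hn => absurd hIN hn

theorem inner_commutator {A : Type*} [Ring A] [Algebra ℂ A] (hq : q ≠ 0) {K : ℂ}
    {X v w E F P Q : A} (hE : E + X * v = q • (v * X)) (hF : F + X * w = q • (w * X))
    (hP : P + F * v = q⁻¹ • (v * F)) (hQ : Q + E * w = q ^ 3 • (w * E))
    (h : q ^ 2 • P = Q + K • X) :
    q ^ 2 • (v * w * X) + q ^ 2 • (X * (w * v)) =
      q ^ 4 • (w * v * X) + X * (v * w) + K • X := by
  obtain rfl := eq_sub_of_add_eq hE
  obtain rfl := eq_sub_of_add_eq hF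
  obtain rfl := eq_sub_of_add_eq hP
  obtain rfl := eq_sub_of_add_eq hQ
  have hK := sub_eq_of_eq_add' h
  rw [← hK]
  simp only [mul_sub, sub_mul, mul_smul_comm, smul_mul_assoc, smul_sub, smul_smul, mul_assoc]
  match_scalars <;> field_simp <;> ring

theorem coef_sum_mul_lmon (hq : q ≠ 0) (N M : ℕ) (C : ℕ → ℕ → ℂ) (n : ℕ) :
    coef (sh 0 n + ee 0) ((∑ i ∈ Finset.range N, ∑ j ∈ Finset.range M,
      C i j • lmon q (sh 0 (i + j))) * lmon q (ee 0)) =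
    q ^ (4 * n) * ∑ i ∈ Finset.range N, ∑ j ∈ Finset.range M, if i + j = n then C i j else 0 := by
  simp only [Finset.sum_mul, map_sum, Finset.mul_sum, smul_mul_assoc, map_smul, lmon_mul_lmon hq,
    coef_lmon, add_left_inj, (sh_injective 0).eq_iff]
  refine Finset.sum_congr rfl fun i _ => Finset.sum_congr rfl fun j _ => ?_
  split_ifs with h
  · have : tw (sh 0 (i + j)) (ee 0) = ((4 * n : ℕ) : ℤ) := by
      rw [h]
      simp [tw, sh, ee]
      ring
    rw [this, zpow_natCast, smul_eq_mul, smul_eq_mul]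
    ring
  · simp

theorem coef_lmon_mul_sum (hq : q ≠ 0) (N M : ℕ) (C : ℕ → ℕ → ℂ) (n : ℕ) :
    coef (sh 0 n + ee 0) (lmon q (ee 0) * ∑ i ∈ Finset.range N, ∑ j ∈ Finset.range M,
      C i j • lmon q (sh 0 (i + j))) =
    ∑ i ∈ Finset.range N, ∑ j ∈ Finset.range M, if i + j = n then C i j else 0 := by
  simp only [map_sum, Finset.mul_sum, mul_smul_comm, map_smul, lmon_mul_lmon hq,
    coef_lmon, add_comm (ee 0), add_left_inj, (sh_injective 0).eq_iff]
  refine Finset.sum_congr rfl fun i _ => Finset.sum_congr rfl fun j _ => ?_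
  have : tw (ee 0) (sh 0 (i + j)) = 0 := by simp [tw, ee]
  split_ifs with h
  · simp [this]
  · simp

theorem sh_add_sh_neg (s : ℤ × ℤ × ℤ) (i j : ℕ) : sh s i + sh (-s) j = sh 0 (i + j) := by
  simp [sh]
  ring_nf
  trivial

/-- The exponents by which `e₁` and `e₂` shift monomials. -/
def root : Fin 2 → ℤ × ℤ × ℤ := ![(1, -1, 0), (0, 1, 0)]

theorem wt_root (m l : Fin 2) : wt m (root l) = cartan 2 m l := by
  fin_cases m <;> fin_cases l <;> simp [wt, root, cartan]

theorem tw_sh_root (l : Fin 2) (i j : ℕ) :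
    tw (sh (root l) i) (sh (-root l) j) = tw (sh (-root l) j) (sh (root l) i) - 2 * (i + j) := by
  fin_cases l <;> simp [tw, sh, root] <;> ring

theorem tw_root (l : Fin 2) : tw (root l) (-root l) = tw (-root l) (root l) := by
  fin_cases l <;> simp [tw, root]

theorem inner_pair_eq (hq : q ≠ 0) (hq' : ∀ N : ℕ, 0 < N → q ^ N ≠ 1) (l : Fin 2) {N M : ℕ}
    {c d : ℕ → ℂ} (hc : ∀ j, N ≤ j → c j = 0) (hd : ∀ j, M ≤ j → d j = 0) {K : ℂ} (hK : K ≠ 0)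
    {v w : End ℂ Laurent} (hv : v = ∑ j ∈ Finset.range N, c j • lmon q (sh (root l) j))
    (hw : w = ∑ j ∈ Finset.range M, d j • lmon q (sh (-root l) j))
    (h : q ^ 2 • (v * w * lmon q (ee 0)) + q ^ 2 • (lmon q (ee 0) * (w * v)) =
      q ^ 4 • (w * v * lmon q (ee 0)) + lmon q (ee 0) * (v * w) + K • lmon q (ee 0)) :
    (∀ j, 0 < j → c j = 0) ∧ (∀ j, 0 < j → d j = 0) ∧
      c 0 * d 0 * (q ^ tw (root l) (-root l) * (1 - q ^ 2) * (q ^ 2 - 1)) = K := by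
  have hvw : v * w = ∑ i ∈ Finset.range N, ∑ j ∈ Finset.range M,
      (c i * d j * q ^ tw (sh (root l) i) (sh (-root l) j)) • lmon q (sh 0 (i + j)) := by
    rw [hv, hw, Finset.sum_mul_sum]
    simp only [smul_mul_smul_comm, lmon_mul_lmon hq, smul_smul, sh_add_sh_neg]
  have hwv : w * v = ∑ i ∈ Finset.range N, ∑ j ∈ Finset.range M,
      (c i * d j * q ^ tw (sh (-root l) j) (sh (root l) i)) • lmon q (sh 0 (i + j)) := by
    rw [hv, hw, Finset.sum_mul_sum, Finset.sum_comm]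
    simp only [smul_mul_smul_comm, lmon_mul_lmon hq, smul_smul, add_comm (sh (-root l) _),
      sh_add_sh_neg, mul_comm (d _)]
  have key := eq_zero_of_sum_antidiagonal hc hd (K := K)
    (G := fun i j => (q ^ tw (sh (root l) i) (sh (-root l) j) -
      q ^ (2 + tw (sh (-root l) j) (sh (root l) i))) * (q ^ (4 * (i + j) + 2) - 1))
    (fun i j => mul_ne_zero
      (zpow_sub_zpow_ne_zero hq hq' (by rw [tw_sh_root]; omega))
      (sub_ne_zero.mpr (hq' _ (by omega)))) hK ?_
  · refine ⟨key.1, key.2.1, ?_⟩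
    rw [← key.2.2, sh_zero, sh_zero, zpow_add₀ hq, tw_root]
    norm_cast
    ring
  · intro n
    have hn := congrArg (coef (sh 0 n + ee 0)) h
    rw [hvw, hwv] at hn
    simp only [map_add, map_smul, coef_sum_mul_lmon hq, coef_lmon_mul_sum hq, smul_eq_mul] at hn
    have h0 : coef (sh 0 n + ee 0) (lmon q (ee 0)) = if n = 0 then 1 else 0 := by
      rw [coef_lmon]
      congr 1
      simp [sh, eq_comm, Prod.ext_iff]
    rw [h0, mul_ite, mul_one, mul_zero] at hn
    rw [← sub_eq_iff_eq_add'] at hn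
    rw [← hn]
    simp only [Finset.mul_sum, ← Finset.sum_add_distrib, ← Finset.sum_sub_distrib]
    refine Finset.sum_congr rfl fun i _ => Finset.sum_congr rfl fun j _ => ?_
    split_ifs with hij
    · rw [hij, zpow_add₀ hq]
      norm_cast
      ring
    · ring


/-! ### Classification -/

section Classification

variable {π : UqslMA q 2 (QSpace q 3)}

theorem actsByWeight (hπ : KCond17 q π) (l : Fin 2) : ActsByWeight q l (π.k l) := by
  obtain ⟨h1, h2, h3, h4, h5, h6⟩ := hπ
  simp only [Z1, Z2, Z3] at h1 h2 h3 h4 h5 h6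
  intro i
  fin_cases l <;> fin_cases i <;> simp [wt, ee, *]

/-- The operator `k_l f_l`, which satisfies the same twisted Leibniz rule as `e_l`. -/
def kf (π : UqslMA q 2 (QSpace q 3)) (l : Fin 2) : QSpace q 3 →ₗ[ℂ] QSpace q 3 :=
  (π.k l).toLinearMap ∘ₗ π.f l

theorem kf_apply (l : Fin 2) (a : QSpace q 3) : kf π l a = π.k l (π.f l a) := rfl

theorem kf_mul (l : Fin 2) (a b : QSpace q 3) :
    kf π l (a * b) = a * kf π l b + kf π l a * π.k l b := by
  simp only [kf_apply, π.f_mul, map_add, map_mul, AlgEquiv.apply_symm_apply]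

theorem k_e (m l : Fin 2) (a : QSpace q 3) :
    π.k m (π.e l a) = q ^ cartan 2 m l • π.e l (π.k m a) := by
  simpa using π.ke m l (π.k m a)

theorem k_f (m l : Fin 2) (a : QSpace q 3) :
    π.k m (π.f l a) = q ^ (-cartan 2 m l) • π.f l (π.k m a) := by
  simpa using π.kf m l (π.k m a)

theorem k_kf (m l : Fin 2) (a : QSpace q 3) :
    π.k m (kf π l a) = q ^ (-cartan 2 m l) • kf π l (π.k m a) := by
  rw [kf_apply, π.k_comm, k_f, map_smul, kf_apply]

theorem k_e_Xg (hq : q ≠ 0) (hπ : KCond17 q π) (m l : Fin 2) (i : Fin 3) :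
    π.k m (π.e l (Xg q 3 i)) = q ^ wt m (root l + ee i) • π.e l (Xg q 3 i) := by
  rw [k_e, actsByWeight hπ m i, map_smul, smul_smul, ← zpow_add₀ hq, wt_add, wt_root]

theorem k_kf_Xg (hq : q ≠ 0) (hπ : KCond17 q π) (m l : Fin 2) (i : Fin 3) :
    π.k m (kf π l (Xg q 3 i)) = q ^ wt m (-root l + ee i) • kf π l (Xg q 3 i) := by
  rw [k_kf, actsByWeight hπ m i, map_smul, smul_smul, ← zpow_add₀ hq, wt_add, wt_neg, wt_root]

theorem exists_sh_of_coef_ne_zero (hq : q ≠ 0) (hq' : ∀ N : ℕ, 0 < N → q ^ N ≠ 1)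
    (hπ : KCond17 q π) {s : ℤ × ℤ × ℤ} (hs : s.2.2 = 0) {i : Fin 3} {a : QSpace q 3}
    (ha : ∀ m, π.k m a = q ^ wt m (s + ee i) • a) (p : ℤ × ℤ × ℤ)
    (hp : coef p (emb q hq a) ≠ 0) : ∃ j, sh s j + ee i = p := by
  have h0 := (actsByWeight hπ 0).wt_eq hq hq' (ha 0) hp
  have h1 := (actsByWeight hπ 1).wt_eq hq hq' (ha 1) hp
  obtain ⟨⟨a, b, c⟩, rfl⟩ := exists_castExp_of_coef_ne_zero hq hp
  obtain ⟨s1, s2, s3⟩ := s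
  obtain rfl : s3 = 0 := hs
  refine ⟨(a - s1 - (ee i).1).toNat, ?_⟩
  fin_cases i <;> simp [wt, ee, castExp, sh] at h0 h1 ⊢ <;> omega

theorem lam_root_ne_zero (hq : q ≠ 0) (hq' : ∀ N : ℕ, 0 < N → q ^ N ≠ 1) (l : Fin 2) (j : ℕ) :
    ∃ i, lam q l (sh (root l) j) i ≠ 0 := by
  fin_cases l
  · by_cases hj : j = 1
    · refine ⟨0, zpow_sub_zpow_ne_zero hq hq' ?_⟩
      simp [wt, ee, tw, sh, root, hj]
    · refine ⟨1, zpow_sub_zpow_ne_zero hq hq' ?_⟩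
      simp [wt, ee, tw, sh, root]
      omega
  · refine ⟨0, zpow_sub_zpow_ne_zero hq hq' ?_⟩
    simp [wt, ee, tw, sh, root]
    omega

theorem lam_neg_root_ne_zero (hq : q ≠ 0) (hq' : ∀ N : ℕ, 0 < N → q ^ N ≠ 1) (l : Fin 2) (j : ℕ) :
    ∃ i, lam q l (sh (-root l) j) i ≠ 0 := by
  fin_cases l
  · refine ⟨0, zpow_sub_zpow_ne_zero hq hq' ?_⟩
    simp [wt, ee, tw, sh, root]
    omega
  · refine ⟨1, zpow_sub_zpow_ne_zero hq hq' ?_⟩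
    simp [wt, ee, tw, sh, root]
    omega

theorem root_snd_snd (l : Fin 2) : (root l).2.2 = 0 := by
  fin_cases l <;> rfl

theorem emb_map_Xg_of_inner (hq : q ≠ 0) {l : Fin 2} {k : QSpace q 3 ≃ₐ[ℂ] QSpace q 3}
    {D : QSpace q 3 →ₗ[ℂ] QSpace q 3} (hk : ActsByWeight q l k) {s : ℤ × ℤ × ℤ} {N : ℕ}
    {c : ℕ → ℂ} (hcN : ∀ j, N ≤ j → c j = 0) (hc : ∀ j, 0 < j → c j = 0)
    (h : ∀ a, emb q hq (D a) + emb q hq a * ∑ j ∈ Finset.range N, c j • lmon q (sh s j) =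
      (∑ j ∈ Finset.range N, c j • lmon q (sh s j)) * emb q hq (k a)) (i : Fin 3) :
    emb q hq (D (Xg q 3 i)) = (c 0 * lam q l s i) • lmon q (s + ee i) := by
  have hsum : ∑ j ∈ Finset.range N, c j • lmon q (sh s j) = c 0 • lmon q s := by
    rw [Finset.sum_eq_single 0, sh_zero]
    · intro j _ hj
      rw [hc j (Nat.pos_of_ne_zero hj), zero_smul]
    · intro h0
      rw [hcN 0 (by simpa using h0), zero_smul]
  have hi := h (Xg q 3 i)
  rw [hsum, hk i, map_smul, emb_Xg, smul_mul_smul_comm, mul_smul_comm, lmon_mul_lmon hq,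
    lmon_mul_lmon hq, smul_smul, smul_smul, add_comm (ee i)] at hi
  have key : emb q hq (D (Xg q 3 i)) + (c 0 * q ^ tw (ee i) s) • lmon q (s + ee i) =
      (c 0 * lam q l s i) • lmon q (s + ee i) + (c 0 * q ^ tw (ee i) s) • lmon q (s + ee i) := by
    rw [hi, ← add_smul, lam, zpow_add₀ hq]
    congr 1
    ring
  exact LinearMap.ext fun x => add_right_cancel (LinearMap.congr_fun key x)

theorem k_Xg_zero (hπ : KCond17 q π) (l : Fin 2) : π.k l (Xg q 3 0) = q • Xg q 3 0 := by
  have := actsByWeight hπ l 0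
  fin_cases l <;> simpa [wt, ee] using this

theorem e_kf_Xg_zero (hπ : KCond17 q π) (l : Fin 2) :
    q ^ 2 • π.e l (kf π l (Xg q 3 0)) =
      kf π l (π.e l (Xg q 3 0)) + ((q - q⁻¹)⁻¹ * (q ^ 2 - 1)) • Xg q 3 0 := by
  have hX := k_Xg_zero hπ l
  have h := congrArg (π.k l) (π.ef l l (Xg q 3 0))
  rw [if_pos rfl, map_sub, map_smul, map_sub, AlgEquiv.apply_symm_apply, hX, map_smul, hX, k_e,
    sub_eq_iff_eq_add'] at h
  have hc : cartan 2 l l = 2 := by simp [cartan]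
  rw [hc] at h
  rw [kf_apply, kf_apply]
  refine Eq.trans ?_ (h.trans ?_)
  · norm_cast
  · module

theorem exists_e_kf (hq : q ≠ 0) (hq' : ∀ N : ℕ, 0 < N → q ^ N ≠ 1) (hπ : KCond17 q π)
    (l : Fin 2) : ∃ c d : ℂ,
      (∀ i, emb q hq (π.e l (Xg q 3 i)) = (c * lam q l (root l) i) • lmon q (root l + ee i)) ∧
      (∀ i, emb q hq (kf π l (Xg q 3 i)) =
        (d * lam q l (-root l) i) • lmon q (-root l + ee i)) ∧
      c * d * (q ^ tw (root l) (-root l) * (1 - q ^ 2) * (q ^ 2 - 1)) =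
        (q - q⁻¹)⁻¹ * (q ^ 2 - 1) := by
  have hk := actsByWeight hπ l
  obtain ⟨N, c, hc, hcD⟩ := exists_inner hq hk (π.e_mul l) (s := root l)
    (fun i => exists_sh_of_coef_ne_zero hq hq' hπ (root_snd_snd l)
      fun m => k_e_Xg hq hπ m l i) (lam_root_ne_zero hq hq' l)
  obtain ⟨M, d, hd, hdD⟩ := exists_inner hq hk (kf_mul (π := π) l) (s := -root l)
    (fun i => exists_sh_of_coef_ne_zero hq hq' hπ (by simp [root_snd_snd l])
      fun m => k_kf_Xg hq hπ m l i) (lam_neg_root_ne_zero hq hq' l)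
  have hK : (q - q⁻¹)⁻¹ * (q ^ 2 - 1) ≠ 0 :=
    mul_ne_zero (inv_ne_zero (sub_inv_ne_zero hq hq')) (sub_ne_zero.mpr (hq' 2 (by norm_num)))
  have hX := k_Xg_zero hπ l
  have hcl : cartan 2 l l = 2 := by simp [cartan]
  have hE := hcD (Xg q 3 0)
  have hF := hdD (Xg q 3 0)
  have hP := hcD (kf π l (Xg q 3 0))
  have hQ := hdD (π.e l (Xg q 3 0))
  rw [hX, map_smul, mul_smul_comm, emb_Xg] at hE hF
  rw [k_kf, hX, hcl, map_smul, map_smul, map_smul, smul_smul, ← zpow_add_one₀ hq, mul_smul_comm] at hP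
  rw [k_e, hX, hcl, map_smul, map_smul, map_smul, smul_smul, ← zpow_add_one₀ hq, mul_smul_comm] at hQ
  have hrel := congrArg (emb q hq) (e_kf_Xg_zero hπ l)
  rw [map_smul, map_add, map_smul, emb_Xg] at hrel
  rw [show (-2 + 1 : ℤ) = -1 by norm_num, zpow_neg_one] at hP
  rw [show (2 + 1 : ℤ) = (3 : ℕ) by norm_num, zpow_natCast] at hQ
  obtain ⟨hc', hd', hcd⟩ := inner_pair_eq hq hq' l hc hd hK rfl rfl
    (inner_commutator (A := End ℂ Laurent) hq hE hF hP hQ hrel)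
  exact ⟨c 0, d 0, emb_map_Xg_of_inner hq hk hc hc' hcD, emb_map_Xg_of_inner hq hk hd hd' hdD, hcd⟩


theorem eq_smul_mon (hq : q ≠ 0) {x : QSpace q 3} {r r' : ℂ} {p : ℤ × ℤ × ℤ} {a b c : ℕ}
    (h : emb q hq x = r • lmon q p) (hr : r = r') (hp : p = ((a : ℤ), (b : ℤ), (c : ℤ))) :
    x = r' • mon q a b c := by
  apply emb_injective hq
  rw [h, map_smul, emb_mon, hr, hp]

theorem eq_zero_of_emb (hq : q ≠ 0) {x : QSpace q 3} {r : ℂ} {p : ℤ × ℤ × ℤ}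
    (h : emb q hq x = r • lmon q p) (hr : r = 0) : x = 0 := by
  apply emb_injective hq
  rw [h, map_zero, hr, zero_smul]

theorem exists_e_f (hq : q ≠ 0) (hq' : ∀ N : ℕ, 0 < N → q ^ N ≠ 1) (hπ : KCond17 q π)
    (l : Fin 2) : ∃ c d : ℂ,
      (∀ i, emb q hq (π.e l (Xg q 3 i)) = (c * lam q l (root l) i) • lmon q (root l + ee i)) ∧
      (∀ i, emb q hq (π.f l (Xg q 3 i)) =
        (q ^ (2 - wt l (ee i)) * d * lam q l (-root l) i) • lmon q (-root l + ee i)) ∧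
      c * d * (q ^ tw (root l) (-root l) * (1 - q ^ 2) * (q ^ 2 - 1)) = q := by
  obtain ⟨c, d, hc, hd, hcd⟩ := exists_e_kf hq hq' hπ l
  refine ⟨c, d, hc, fun i => ?_, ?_⟩
  · have h : π.f l (Xg q 3 i) = q ^ (2 - wt l (ee i)) • kf π l (Xg q 3 i) := by
      have hcl : cartan 2 l l = 2 := by simp [cartan]
      rw [kf_apply, k_f, actsByWeight hπ l i, map_smul, hcl, smul_smul, smul_smul, ← zpow_add₀ hq,
        ← zpow_add₀ hq,
        show 2 - wt l (ee i) + -2 + wt l (ee i) = 0 by ring, zpow_zero, one_smul]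
    rw [h, map_smul, hd, smul_smul, mul_assoc]
  · rw [hcd]
    have := sub_inv_ne_zero hq hq'
    have h2 : q ^ 2 - 1 = q * (q - q⁻¹) := by field_simp
    rw [h2, mul_comm q, inv_mul_cancel_left₀ this]

theorem efDesc_of_kCond (hq : q ≠ 0) (hq' : ∀ N : ℕ, 0 < N → q ^ N ≠ 1) (hπ : KCond17 q π) :
    ∃ a₂ e₀ : ℂ, a₂ ≠ 0 ∧ e₀ ≠ 0 ∧ EFDesc17 q π a₂ e₀ := by
  obtain ⟨c, d, he, hf, hcd⟩ := exists_e_f hq hq' hπ 0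
  obtain ⟨c', d', he', hf', hcd'⟩ := exists_e_f hq hq' hπ 1
  have hα : c * (q⁻¹ - q) * (q * d * (q ^ 2 - 1)) = 1 := by
    have : tw (root 0) (-root 0) = 1 := by simp [tw, root]
    rw [this, zpow_one] at hcd
    apply mul_left_cancel₀ hq
    linear_combination hcd + q * c * d * (q ^ 2 - 1) * mul_inv_cancel₀ hq
  have hε : c' * (q ^ 2 - 1) * (d' * (q ^ 2 - 1)) = -q := by
    have : tw (root 1) (-root 1) = 0 := by simp [tw, root]
    rw [this, zpow_zero] at hcd'
    linear_combination -hcd'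
  have ha : c * (q⁻¹ - q) ≠ 0 := left_ne_zero_of_mul_eq_one hα
  have hd0 : d' * (q ^ 2 - 1) ≠ 0 := by
    intro h
    rw [h, mul_zero, zero_eq_neg] at hε
    exact hq hε
  have hc' : c' * (q ^ 2 - 1) = -q * (d' * (q ^ 2 - 1))⁻¹ := by
    rw [← hε, mul_inv_cancel_right₀ hd0]
  have hc'' : c' * (q⁻¹ - q) = (d' * (q ^ 2 - 1))⁻¹ := by
    apply mul_left_cancel₀ hq
    linear_combination -hc' + c' * mul_inv_cancel₀ hq
  have h11 : Z1 q * Z2 q = mon q 1 1 0 := by simp [mon]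
  have h22 : Z2 q ^ 2 = mon q 0 2 0 := by simp [mon]
  have h23 : Z2 q * Z3 q = mon q 0 1 1 := by simp [mon]
  refine ⟨c * (q⁻¹ - q), d' * (q ^ 2 - 1), ha, hd0, ?_⟩
  rw [EFDesc17, h11, h22, h23, ← mon_zero]
  refine ⟨eq_zero_of_emb hq (he 0) ?_, Eq.trans (eq_smul_mon hq (he 1) ?_ ?_) (by rw [Z1_eq_mon]),
    eq_zero_of_emb hq (he 2) ?_, eq_smul_mon hq (he' 0) ?_ ?_, eq_smul_mon hq (he' 1) ?_ ?_,
    eq_smul_mon hq (he' 2) ?_ ?_, Eq.trans (eq_smul_mon hq (hf 0) ?_ ?_) (by rw [Z2_eq_mon]),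
    eq_zero_of_emb hq (hf 1) ?_, eq_zero_of_emb hq (hf 2) ?_, eq_zero_of_emb hq (hf' 0) ?_,
    eq_smul_mon hq (hf' 1) ?_ ?_, eq_zero_of_emb hq (hf' 2) ?_⟩
  · simp [lam, wt, ee, tw, root]
  · simp [lam, wt, ee, tw, root]
  · simp [ee, root]
  · simp [lam, wt, ee, tw, root]
  · rw [← hc']
    simp [lam, wt, ee, tw, root]
  · simp [ee, root]
  · rw [← hc']
    simp [lam, wt, ee, tw, root]
  · simp [ee, root]
  · rw [← hc'']
    simp [lam, wt, ee, tw, root]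
  · simp [ee, root]
  · rw [← eq_inv_of_mul_eq_one_right hα]
    simp [lam, wt, ee, tw, root]
  · simp [ee, root]
  · simp [lam, wt, ee, tw, root]
  · simp [lam, wt, ee, tw, root]
  · simp [lam, wt, ee, tw, root]
  · simp [lam, wt, ee, tw, root]
  · simp [ee, root]
  · simp [lam, wt, ee, tw, root]

theorem intertwine {ψ : QSpace q 3 →ₐ[ℂ] QSpace q 3} {D D' : QSpace q 3 →ₗ[ℂ] QSpace q 3}
    {σ τ σ' τ' : QSpace q 3 → QSpace q 3} (hD : ∀ a b, D (a * b) = σ a * D b + D a * τ b)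
    (hD' : ∀ a b, D' (a * b) = σ' a * D' b + D' a * τ' b) (h1 : D 1 = 0) (h1' : D' 1 = 0)
    (hσ : ∀ a, ψ (σ a) = σ' (ψ a)) (hτ : ∀ a, ψ (τ a) = τ' (ψ a))
    (hX : ∀ i, ψ (D (Xg q 3 i)) = D' (ψ (Xg q 3 i))) (a : QSpace q 3) : ψ (D a) = D' (ψ a) := by
  induction a using induction_gen with
  | hc c => simp only [Algebra.algebraMap_eq_smul_one, map_smul, map_one, h1, h1', map_zero]
  | hX i => exact hX i
  | hadd a b ha hb => simp only [map_add, ha, hb]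
  | hmul a b ha hb => simp only [hD, hD', map_add, map_mul, ha, hb, hσ, hτ]

theorem iso_of_efDesc {π' : UqslMA q 2 (QSpace q 3)} (hπ : KCond17 q π) (hπ' : KCond17 q π')
    {a₂ e₀ : ℂ} (ha : a₂ ≠ 0) (he : e₀ ≠ 0) (h : EFDesc17 q π a₂ e₀) (h' : EFDesc17 q π' 1 1) :
    π.Iso π' := by
  have ht : ∀ i, (![e₀ / a₂, e₀, 1] : Fin 3 → ℂ) i ≠ 0 := by
    intro i
    fin_cases i <;> simp [ha, he]
  set ψ := scale q _ ht with hψ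
  have ψ1 : ψ (Xg q 3 0) = (e₀ / a₂) • Xg q 3 0 := scale_Xg _ ht 0
  have ψ2 : ψ (Xg q 3 1) = e₀ • Xg q 3 1 := scale_Xg _ ht 1
  have ψ3 : ψ (Xg q 3 2) = Xg q 3 2 := (scale_Xg _ ht 2).trans (one_smul _ _)
  have hk : ∀ l a, ψ (π.k l a) = π'.k l (ψ a) := by
    intro l a
    refine DFunLike.congr_fun (algHom_ext (f := (ψ : QSpace q 3 →ₐ[ℂ] QSpace q 3).comp
      (π.k l : QSpace q 3 →ₐ[ℂ] QSpace q 3)) (g := (π'.k l : QSpace q 3 →ₐ[ℂ] QSpace q 3).comp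
      (ψ : QSpace q 3 →ₐ[ℂ] QSpace q 3)) fun i => ?_) a
    simp only [AlgHom.comp_apply, AlgEquiv.coe_toAlgHom, actsByWeight hπ l i, map_smul, hψ,
      scale_Xg, actsByWeight hπ' l i]
    rw [smul_comm]
  have hks : ∀ l a, ψ ((π.k l).symm a) = (π'.k l).symm (ψ a) := by
    intro l a
    rw [AlgEquiv.eq_symm_apply, ← hk, AlgEquiv.apply_symm_apply]
  obtain ⟨e1, e2, e3, e4, e5, e6, f1, f2, f3, f4, f5, f6⟩ := h
  obtain ⟨e1', e2', e3', e4', e5', e6', f1', f2', f3', f4', f5', f6'⟩ := h'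
  simp only [Z1, Z2, Z3] at e1 e2 e3 e4 e5 e6 f1 f2 f3 f4 f5 f6
  simp only [Z1, Z2, Z3] at e1' e2' e3' e4' e5' e6' f1' f2' f3' f4' f5' f6'
  have hE : ∀ l a, ψ (π.e l a) = π'.e l (ψ a) := fun l =>
    intertwine (ψ := ψ) (π.e_mul l) (π'.e_mul l) (π.e_one l) (π'.e_one l) (fun _ => rfl) (hk l)
      fun i => by
        fin_cases l <;> fin_cases i <;>
          simp [ψ1, ψ2, ψ3, e1, e2, e3, e4, e5, e6, e1', e2', e3', e4', e5', e6', smul_smul,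
            pow_two, he]
        all_goals
          congr 1
          field_simp
  have hF : ∀ l a, ψ (π.f l a) = π'.f l (ψ a) := fun l =>
    intertwine (ψ := ψ) (π.f_mul l) (π'.f_mul l) (π.f_one l) (π'.f_one l) (hks l) (fun _ => rfl)
      fun i => by
        fin_cases l <;> fin_cases i <;>
          simp [ψ1, ψ2, ψ3, f1, f2, f3, f4, f5, f6, f1', f2', f3', f4', f5', f6', smul_smul,
            div_eq_inv_mul]
  refine ⟨ψ, fun l a => ?_, fun l a => ?_, fun l a => ?_, fun l a => ?_⟩
  · rw [hk, AlgEquiv.apply_symm_apply]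
  · rw [hks, AlgEquiv.apply_symm_apply]
  · rw [hE, AlgEquiv.apply_symm_apply]
  · rw [hF, AlgEquiv.apply_symm_apply]

end Classification

end QuantumThreeSpace

/-- Classification of `U_q(sl(3))`-module-algebra structures on `A_q(3)` in case
`(A4)|(B7)`: description, converse existence, and isomorphism with the normalized one. -/
theorem Uqsl3_on_Aq3_A4B7 (q : ℂ) (hq : q ≠ 0)
    (hq' : ∀ N : ℕ, 0 < N → q ^ N ≠ 1) :
    (∀ π : UqslMA q 2 (QSpace q 3), KCond17 q π →
      ∃ a₂ e₀ : ℂ, a₂ ≠ 0 ∧ e₀ ≠ 0 ∧ EFDesc17 q π a₂ e₀) ∧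
    (∀ a₂ e₀ : ℂ, a₂ ≠ 0 → e₀ ≠ 0 →
      ∃ π : UqslMA q 2 (QSpace q 3), KCond17 q π ∧ EFDesc17 q π a₂ e₀) ∧
    (∀ π π' : UqslMA q 2 (QSpace q 3),
      KCond17 q π → KCond17 q π' → EFDesc17 q π' 1 1 → π.Iso π') := by
  refine ⟨fun π hπ => QuantumThreeSpace.efDesc_of_kCond hq hq' hπ, fun a₂ e₀ ha he => ?_,
    fun π π' hπ hπ' h' => ?_⟩
  · exact ⟨QuantumThreeSpace.structureOf q hq hq' a₂ e₀ ha he,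
      QuantumThreeSpace.structureOf_kCond hq hq' ha he,
      QuantumThreeSpace.structureOf_efDesc hq hq' ha he⟩
  · obtain ⟨a₂, e₀, ha, he, h⟩ := QuantumThreeSpace.efDesc_of_kCond hq hq' hπ
    exact QuantumThreeSpace.iso_of_efDesc hπ hπ' ha he h h'
end
end
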